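/- arXiv:1511.02162 — 2 statements merged into one kernel-verified Lean document; each statement's English description precedes it below -/
import Mathlib

section
/- Let α/2 < λ < 1 + α/2. Then there exist constants 0 < c₁ ≤ c₂, depending only on N, α and λ, such that for every x ∈ B, c₁ δ(x)^{α−λ} ≤ ∫_B G_B^α(x,y) δ(y)^{−λ} dy ≤ c₂ δ(x)^{α−λ}. -/
open MeasureTheory Real Filter Topology Metric Set

noncomputable section

abbrev EN (N : ℕ) := EuclideanSpace ℝ (Fin N)

/-- The normalizing constant `c_{N,α}` of the fractional Laplacian. -/
def fracLapCoeff (N : ℕ) (α : ℝ) : ℝ :=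
  2 ^ α * Real.pi ^ (-(N : ℝ) / 2) * Real.Gamma (((N : ℝ) + α) / 2) / |Real.Gamma (-α / 2)|

/-- `HasFracLap N α u x L` means the principal-value limit defining `Δ^{α/2} u (x)` exists
and equals `L`. -/
def HasFracLap (N : ℕ) (α : ℝ) (u : EN N → ℝ) (x : EN N) (L : ℝ) : Prop :=
  Tendsto (fun ε : ℝ =>
      fracLapCoeff N α * ∫ y in {y : EN N | ε < dist y x}, (u y - u x) / dist y x ^ ((N : ℝ) + α))
    (𝓝[>] (0 : ℝ)) (𝓝 L)

/-- The value of the fractional Laplacian at `x` (junk value `0` where the limit fails). -/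
def fracLap (N : ℕ) (α : ℝ) (u : EN N → ℝ) (x : EN N) : ℝ :=
  haveI := Classical.propDecidable (∃ L, HasFracLap N α u x L)
  if h : ∃ L, HasFracLap N α u x L then h.choose else 0

/-- The weighted space `𝓛_α`. -/
def memLalpha (N : ℕ) (α : ℝ) (u : EN N → ℝ) : Prop :=
  Integrable (fun y : EN N => u y * (1 + ‖y‖) ^ (-((N : ℝ) + α)))

/-- `δ(x) = 1 - |x|` on the unit ball, `0` outside. -/
def delta1 {N : ℕ} (x : EN N) : ℝ := if ‖x‖ < 1 then 1 - ‖x‖ else 0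

/-- The constant `κ_{N,α}`. -/
def greenCoeff (N : ℕ) (α : ℝ) : ℝ :=
  Real.Gamma ((N : ℝ) / 2) / (2 ^ α * Real.pi ^ ((N : ℝ) / 2) * Real.Gamma (α / 2) ^ 2)

/-- The Green function of the unit ball. -/
def greenB (N : ℕ) (α : ℝ) (x y : EN N) : ℝ :=
  if ‖x‖ < 1 ∧ ‖y‖ < 1 then
    greenCoeff N α * ‖x - y‖ ^ (α - (N : ℝ)) *
      ∫ s in (0:ℝ)..((1 - ‖x‖ ^ 2) * (1 - ‖y‖ ^ 2) / ‖x - y‖ ^ 2),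
        s ^ (α / 2 - 1) * (1 + s) ^ (-(N : ℝ) / 2)
  else 0

/-- The Green function of the ball `B(a,r)`, by scaling. -/
def greenBall (N : ℕ) (α : ℝ) (a : EN N) (r : ℝ) (x y : EN N) : ℝ :=
  r ^ (α - (N : ℝ)) * greenB N α (r⁻¹ • (x - a)) (r⁻¹ • (y - a))

/-- The constant `c_α^N` of the Poisson kernel. -/
def poissonCoeff (N : ℕ) (α : ℝ) : ℝ :=
  Real.pi ^ (-1 - (N : ℝ) / 2) * Real.Gamma ((N : ℝ) / 2) * Real.sin (Real.pi * α / 2)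

/-- The Poisson kernel of the ball `B(a,r)`. -/
def poissonBall (N : ℕ) (α : ℝ) (a : EN N) (r : ℝ) (x y : EN N) : ℝ :=
  poissonCoeff N α * ((r ^ 2 - ‖x - a‖ ^ 2) / (‖y - a‖ ^ 2 - r ^ 2)) ^ (α / 2) *
    ‖x - y‖ ^ (-(N : ℝ))

/-- The harmonic-measure operator `H^α_{B(a,r)} f`. -/
def Hball (N : ℕ) (α : ℝ) (a : EN N) (r : ℝ) (f : EN N → ℝ) (x : EN N) : ℝ :=
  ∫ y in {y : EN N | r < ‖y - a‖}, poissonBall N α a r x y * f y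

/-- Solution (in the distributional sense) of `Δ^{α/2} u = u^γ` in the open set `U`. -/
def IsSolution (N : ℕ) (α γ : ℝ) (U : Set (EN N)) (u : EN N → ℝ) : Prop :=
  (∀ x, 0 ≤ u x) ∧ ContinuousOn u U ∧ memLalpha N α u ∧
    ∀ φ : EN N → ℝ, ContDiff ℝ (⊤ : ℕ∞) φ → HasCompactSupport φ → tsupport φ ⊆ U →
      (∀ x, 0 ≤ φ x) →
        ∫ x, u x * fracLap N α φ x = ∫ x, u x ^ γ * φ x

/-- The surface measure `σ` on the unit sphere. -/
def sphereMeasure (N : ℕ) : Measure (Metric.sphere (0 : EN N) 1) :=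
  (volume : Measure (EN N)).toSphere

/-- The Martin integral `M_B^α g`. -/
def martinB (N : ℕ) (α : ℝ) (g : Metric.sphere (0 : EN N) 1 → ℝ) (x : EN N) : ℝ :=
  if ‖x‖ < 1 then
    ∫ y, (1 - ‖x‖ ^ 2) ^ (α / 2) * ‖x - (y : EN N)‖ ^ (-(N : ℝ)) * g y ∂(sphereMeasure N)
  else 0

/-- Solution of the moderate blow-up problem `(P_g)`. -/
def IsSolutionPg (N : ℕ) (α γ : ℝ) (g : Metric.sphere (0 : EN N) 1 → ℝ) (u : EN N → ℝ) : Prop :=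
  (∀ x, 0 ≤ u x) ∧ memLalpha N α u ∧ (∀ x : EN N, ¬ ‖x‖ < 1 → u x = 0) ∧
    IsSolution N α γ (Metric.ball (0 : EN N) 1) u ∧
    ∀ z : Metric.sphere (0 : EN N) 1,
      Tendsto (fun x => delta1 x ^ (1 - α / 2) * u x)
        (𝓝[Metric.ball (0 : EN N) 1] (z : EN N)) (𝓝 (g z))

/-- Solution of the blow-up problem `(P_∞)`. -/
def IsSolutionPinf (N : ℕ) (α γ : ℝ) (u : EN N → ℝ) : Prop :=
  (∀ x, 0 ≤ u x) ∧ memLalpha N α u ∧ (∀ x : EN N, ¬ ‖x‖ < 1 → u x = 0) ∧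
    IsSolution N α γ (Metric.ball (0 : EN N) 1) u ∧
    ∀ z : Metric.sphere (0 : EN N) 1,
      Tendsto (fun x => delta1 x ^ (1 - α / 2) * u x)
        (𝓝[Metric.ball (0 : EN N) 1] (z : EN N)) atTop


/-! ### Helper lemmas -/

lemma aux_T (β σ : ℝ) (hβ1 : β < 1) (hσ : 0 < σ) :
    ∫⁻ u : ℝ, (Ioo 0 σ).indicator (fun u => ENNReal.ofReal (u ^ (-β))) u
      = ENNReal.ofReal (σ ^ (1 - β) / (1 - β)) := by
  rw [lintegral_indicator measurableSet_Ioo, restrict_Ioo_eq_restrict_Ioc]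
  rw [← ofReal_integral_eq_lintegral_ofReal]
  · rw [← intervalIntegral.integral_of_le hσ.le, integral_rpow (Or.inl (by linarith))]
    rw [Real.zero_rpow (by linarith)]
    congr 1
    rw [show -β + 1 = 1 - β by ring]; ring
  · have := intervalIntegral.intervalIntegrable_rpow' (a := 0) (b := σ) (r := -β) (by linarith)
    rwa [intervalIntegrable_iff_integrableOn_Ioc_of_le hσ.le] at this
  · filter_upwards [ae_restrict_mem measurableSet_Ioc] with u hu
    exact Real.rpow_nonneg hu.1.le _

lemma aux_scale (N : ℕ) (F : EN N → ENNReal) (ρ : ℝ) (h0 : 0 < ρ) (h1 : ρ ≤ 1) :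
    ∫⁻ y, F y ≤ ∫⁻ z, F (ρ • z) := by
  have hemb : MeasurableEmbedding (fun z : EN N => ρ • z) :=
    (Homeomorph.smulOfNeZero ρ h0.ne').measurableEmbedding
  rw [← hemb.lintegral_map F, Measure.map_addHaar_smul volume h0.ne', lintegral_smul_measure]
  have : (1 : ENNReal) ≤ ENNReal.ofReal |(ρ ^ Module.finrank ℝ (EN N))⁻¹| := by
    rw [← ENNReal.ofReal_one]
    apply ENNReal.ofReal_le_ofReal
    rw [abs_of_nonneg (by positivity)]
    exact (one_le_inv₀ (by positivity)).2 (pow_le_one₀ h0.le h1)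
  calc ∫⁻ y, F y = 1 * ∫⁻ y, F y := (one_mul _).symm
    _ ≤ _ := by rw [smul_eq_mul]; gcongr

lemma aux_vol (N : ℕ) (hN : 3 ≤ N) (x : EN N) (r : ℝ) (hr : 0 ≤ r) :
    volume (ball x r) = ENNReal.ofReal (r ^ N * (volume (ball (0 : EN N) 1)).toReal) := by
  have : Nonempty (Fin N) := ⟨⟨0, by omega⟩⟩
  rw [Measure.addHaar_ball volume x hr, finrank_euclideanSpace, Fintype.card_fin,
    ENNReal.ofReal_mul (by positivity), ENNReal.ofReal_toReal]
  exact measure_ball_lt_top.ne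

lemma aux_volpos (N : ℕ) : 0 < (volume (ball (0 : EN N) 1)).toReal :=
  ENNReal.toReal_pos (measure_ball_pos _ _ one_pos).ne' measure_ball_lt_top.ne

/-- The shell function cut off to a ball. -/
def shellF {N : ℕ} (β : ℝ) (x : EN N) (s : ℝ) : EN N → ENNReal :=
  (ball (0 : EN N) 1 ∩ ball x s).indicator (fun y => ENNReal.ofReal ((1 - ‖y‖) ^ (-β)))

lemma shellF_meas {N : ℕ} (β : ℝ) (x : EN N) (s : ℝ) : Measurable (shellF β x s) := by
  unfold shellF
  apply Measurable.indicator _ (measurableSet_ball.inter measurableSet_ball)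
  fun_prop

lemma aux_b (a : ℝ) (ha : 0 ≤ a) : ∃ b ≤ (1 : ℝ), ∀ ρ, 0 < ρ → ρ < 1 → ρ * a < 1 →
    0 < b - ρ ∧ b - ρ ≤ 1 - ρ * a := by
  by_cases h : a ≤ 1
  · exact ⟨1, le_rfl, fun ρ h0 h1 h2 => ⟨by linarith, by nlinarith⟩⟩
  · push Not at h
    have hi : a⁻¹ * a = 1 := inv_mul_cancel₀ (by linarith)
    refine ⟨a⁻¹, inv_le_one_of_one_le₀ h.le, fun ρ h0 h1 h2 => ?_⟩
    have h3 : 0 < a⁻¹ - ρ := by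
      by_contra hc
      push Not at hc
      nlinarith
    refine ⟨h3, ?_⟩
    nlinarith

lemma shell_small (N : ℕ) (hN : 3 ≤ N) (β : ℝ) (hβ0 : 0 < β) (hβ1 : β < 1) (x : EN N)
    (s : ℝ) (hs : 0 < s) (hs2 : s ≤ 2) :
    ∫⁻ y, shellF β x s y ≤ ENNReal.ofReal
      ((3 ^ N * (volume (ball (0 : EN N) 1)).toReal * 4 ^ β / (1 - β)) * s ^ ((N : ℝ) - β)) := by
  set σ := s / 4 with hσ
  have hσ0 : 0 < σ := by positivity
  have hσ1 : σ ≤ 1 / 2 := by rw [hσ]; linarith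
  have hF := shellF_meas β x s
  set F := shellF β x s with hFdef
  set I := ∫⁻ y, F y
  have hb : (1 : ℝ) - β > 0 := by linarith
  have key : ENNReal.ofReal σ * I ≤
      ENNReal.ofReal ((3 * s) ^ N * (volume (ball (0 : EN N) 1)).toReal) *
        ENNReal.ofReal (σ ^ (1 - β) / (1 - β)) := by
    calc ENNReal.ofReal σ * I = ∫⁻ _ρ in Ioo (1 - σ) 1, I := by
          rw [lintegral_const, Measure.restrict_apply_univ, Real.volume_Ioo, mul_comm]
          congr 2; ring
      _ ≤ ∫⁻ ρ in Ioo (1 - σ) 1, ∫⁻ z, F (ρ • z) := by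
          apply setLIntegral_mono' measurableSet_Ioo
          intro ρ hρ
          exact aux_scale N F ρ (by linarith [hρ.1]) hρ.2.le
      _ = ∫⁻ z, ∫⁻ ρ in Ioo (1 - σ) 1, F (ρ • z) := by
          apply lintegral_lintegral_swap
          apply Measurable.aemeasurable
          exact hF.comp (measurable_fst.smul measurable_snd)
      _ ≤ ∫⁻ z, (ball x (3 * s)).indicator
            (fun _ => ENNReal.ofReal (σ ^ (1 - β) / (1 - β))) z := by
          apply lintegral_mono
          intro z
          have hsupp : ∀ ρ ∈ Ioo (1 - σ) 1, F (ρ • z) ≠ 0 →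
              ρ * ‖z‖ < 1 ∧ ‖ρ • z - x‖ < s := by
            intro ρ hρ hne
            have hm := Set.mem_of_indicator_ne_zero hne
            have h1 := hm.1
            have h2 := hm.2
            rw [mem_ball_zero_iff, norm_smul, Real.norm_of_nonneg (by linarith [hρ.1])] at h1
            rw [mem_ball_iff_norm] at h2
            exact ⟨h1, h2⟩
          by_cases hz : z ∈ ball x (3 * s)
          · rw [Set.indicator_of_mem hz, ← aux_T β σ hβ1 hσ0]
            obtain ⟨b, hb1, hb⟩ := aux_b ‖z‖ (norm_nonneg z)
            rw [← lintegral_sub_left_eq_self _ b]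
            refine le_trans ?_ (setLIntegral_le_lintegral (Ioo (1 - σ) 1) _)
            apply setLIntegral_mono' measurableSet_Ioo
            intro ρ hρ
            by_cases hne : F (ρ • z) = 0
            · rw [hne]; exact zero_le
            · obtain ⟨h1, h2⟩ := hsupp ρ hρ hne
              have hρ0 : 0 < ρ := by linarith [hρ.1]
              obtain ⟨h3, h4⟩ := hb ρ hρ0 hρ.2 h1
              rw [Set.indicator_of_mem (show b - ρ ∈ Ioo 0 σ from ⟨h3, by linarith [hρ.1]⟩)]
              rw [hFdef]; unfold shellF
              refine le_trans (Set.indicator_le_self _ _ _) ?_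
              apply ENNReal.ofReal_le_ofReal
              rw [norm_smul, Real.norm_of_nonneg hρ0.le]
              exact Real.rpow_le_rpow_of_nonpos h3 h4 (by linarith)
          · rw [Set.indicator_of_notMem hz]
            apply le_of_eq
            beta_reduce
            rw [setLIntegral_congr_fun (g := fun _ => 0) measurableSet_Ioo]
            · simp
            · intro ρ hρ
              by_contra hne
              obtain ⟨h1, h2⟩ := hsupp ρ hρ hne
              apply hz
              rw [mem_ball_iff_norm]
              have hρ0 : 1 / 2 < ρ := by linarith [hρ.1]
              have hz2 : ‖z‖ ≤ 2 := by nlinarith [norm_nonneg z]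
              have h5 : ‖z - ρ • z‖ = (1 - ρ) * ‖z‖ := by
                rw [show z - ρ • z = (1 - ρ) • z by rw [sub_smul, one_smul], norm_smul,
                  Real.norm_of_nonneg (by linarith [hρ.2])]
              have h6 : ‖z - x‖ ≤ ‖z - ρ • z‖ + ‖ρ • z - x‖ := by
                have := norm_add_le (z - ρ • z) (ρ • z - x)
                simpa using this
              have h7 : (1 - ρ) * ‖z‖ ≤ σ * 2 := by
                apply mul_le_mul _ hz2 (norm_nonneg _) hσ0.le
                linarith [hρ.1]
              rw [hσ] at h7
              linarith
      _ = _ := by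
          rw [lintegral_indicator measurableSet_ball, setLIntegral_const,
            aux_vol N hN x (3 * s) (by positivity), mul_comm]
  have hσne : ENNReal.ofReal σ ≠ 0 := by simpa using hσ0
  rw [← ENNReal.mul_le_mul_iff_right hσne ENNReal.ofReal_ne_top]
  refine key.trans ?_
  rw [← ENNReal.ofReal_mul (by positivity), ← ENNReal.ofReal_mul hσ0.le]
  apply ENNReal.ofReal_le_ofReal
  apply le_of_eq
  rw [Real.rpow_sub hs, Real.rpow_natCast, Real.rpow_sub hσ0, Real.rpow_one, hσ,
    Real.div_rpow hs.le (by norm_num)]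
  have := (Real.rpow_pos_of_pos hs β).ne'
  have := (Real.rpow_pos_of_pos (show (0:ℝ) < 4 by norm_num) β).ne'
  rw [mul_pow]
  field_simp

lemma shell_all (N : ℕ) (hN : 3 ≤ N) (β : ℝ) (hβ0 : 0 < β) (hβ1 : β < 1) :
    ∃ C : ℝ, 0 < C ∧ ∀ (x : EN N), ‖x‖ < 1 → ∀ s : ℝ, 0 < s →
    ∫⁻ y, shellF β x s y ≤ ENNReal.ofReal (C * s ^ ((N : ℝ) - β)) := by
  have hv := aux_volpos N
  have hb : (1 : ℝ) - β > 0 := by linarith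
  refine ⟨3 ^ N * (volume (ball (0 : EN N) 1)).toReal * 4 ^ β / (1 - β), ?_,
    fun x hx s hs => ?_⟩
  rotate_left
  · rcases le_total s 2 with h | h
    · exact shell_small N hN β hβ0 hβ1 x s hs h
    · calc ∫⁻ y, shellF β x s y ≤ ∫⁻ y, shellF β x 2 y := by
            apply lintegral_mono
            apply Set.indicator_le_indicator_of_subset
            · intro y hy
              refine ⟨hy.1, ?_⟩
              have := hy.1
              rw [mem_ball_zero_iff] at this
              rw [mem_ball_iff_norm]
              linarith [norm_sub_le y x]
            · intro y; exact zero_le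
        _ ≤ _ := shell_small N hN β hβ0 hβ1 x 2 (by norm_num) le_rfl
        _ ≤ _ := by
            apply ENNReal.ofReal_le_ofReal
            have h3 : (3 : ℝ) ≤ N := by exact_mod_cast hN
            have := Real.rpow_le_rpow (by norm_num) h (show (0:ℝ) ≤ N - β by linarith)
            exact mul_le_mul_of_nonneg_left this (by positivity)
  · positivity

/-- Far part. -/
lemma far_part (N : ℕ) (hN : 3 ≤ N) (β : ℝ) (hβ0 : 0 < β) (hβ1 : β < 1) :
    ∃ C : ℝ, 0 < C ∧ ∀ (x : EN N), ‖x‖ < 1 → ∀ e : ℝ, 0 < e →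
    ∫⁻ y, (ball (0 : EN N) 1 \ ball x e).indicator
      (fun y => ENNReal.ofReal ((1 - ‖y‖) ^ (-β) * ‖x - y‖ ^ (-(N : ℝ)))) y
      ≤ ENNReal.ofReal (C * e ^ (-β)) := by
  obtain ⟨C, hC, hK⟩ := shell_all N hN β hβ0 hβ1
  set q : ℝ := 2 ^ (-β) with hq
  have hq0 : 0 < q := by positivity
  have hq1 : q < 1 := Real.rpow_lt_one_of_one_lt_of_neg (by norm_num) (by linarith)
  refine ⟨C * 2 ^ ((N : ℝ) - β) * (1 - q)⁻¹, ?_, fun x hx e he => ?_⟩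
  · have : 0 < 1 - q := by linarith
    positivity
  have hpt : ∀ y, (ball (0 : EN N) 1 \ ball x e).indicator
      (fun y => ENNReal.ofReal ((1 - ‖y‖) ^ (-β) * ‖x - y‖ ^ (-(N : ℝ)))) y ≤
      ∑' k : ℕ, ENNReal.ofReal ((2 ^ k * e) ^ (-(N : ℝ))) * shellF β x (2 ^ (k + 1) * e) y := by
    intro y
    by_cases hy : y ∈ ball (0 : EN N) 1 \ ball x e
    · rw [Set.indicator_of_mem hy]
      obtain ⟨hy1, hy2⟩ := hy
      rw [mem_ball_iff_norm, not_lt, norm_sub_rev] at hy2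
      obtain ⟨k, hk1, hk2⟩ := exists_nat_pow_near ((one_le_div he).2 hy2) (one_lt_two (α := ℝ))
      rw [le_div_iff₀ he] at hk1
      rw [div_lt_iff₀ he] at hk2
      refine le_trans ?_ (ENNReal.le_tsum k)
      unfold shellF
      rw [Set.indicator_of_mem (show y ∈ ball (0 : EN N) 1 ∩ ball x (2 ^ (k + 1) * e) from
        ⟨hy1, by rwa [mem_ball_iff_norm, norm_sub_rev]⟩),
        ← ENNReal.ofReal_mul (by positivity), mul_comm]
      apply ENNReal.ofReal_le_ofReal
      rw [mem_ball_zero_iff] at hy1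
      apply mul_le_mul_of_nonneg_right _ (Real.rpow_nonneg (by linarith) _)
      exact Real.rpow_le_rpow_of_nonpos (by positivity) hk1 (by simp)
    · rw [Set.indicator_of_notMem hy]; exact zero_le
  refine (lintegral_mono hpt).trans ?_
  rw [lintegral_tsum (fun k => ((shellF_meas β x _).const_mul _).aemeasurable)]
  have hterm : ∀ k : ℕ, ∫⁻ y, ENNReal.ofReal ((2 ^ k * e) ^ (-(N : ℝ))) *
      shellF β x (2 ^ (k + 1) * e) y ≤
      ENNReal.ofReal (C * 2 ^ ((N : ℝ) - β) * e ^ (-β) * q ^ k) := by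
    intro k
    rw [lintegral_const_mul _ (shellF_meas β x _)]
    calc _ ≤ ENNReal.ofReal ((2 ^ k * e) ^ (-(N : ℝ))) *
          ENNReal.ofReal (C * (2 ^ (k + 1) * e) ^ ((N : ℝ) - β)) := by
          gcongr
          exact hK x hx _ (by positivity)
      _ = _ := by
          rw [← ENNReal.ofReal_mul (by positivity)]
          congr 1
          have h2 : (2 : ℝ) ^ (k + 1) * e = 2 * (2 ^ k * e) := by ring
          rw [h2, Real.mul_rpow (x := 2) (by norm_num) (by positivity)]
          have h3 : (2 ^ k * e : ℝ) ^ (-(N : ℝ)) * (2 ^ k * e : ℝ) ^ ((N : ℝ) - β)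
              = q ^ k * e ^ (-β) := by
            rw [← Real.rpow_add (by positivity), show -(N : ℝ) + (N - β) = -β by ring,
              Real.mul_rpow (by positivity) he.le, hq, ← Real.rpow_natCast, ← Real.rpow_natCast,
              ← Real.rpow_mul (by norm_num), ← Real.rpow_mul (by norm_num), mul_comm (k : ℝ)]
          linear_combination (C * 2 ^ ((N : ℝ) - β)) * h3
  refine (ENNReal.tsum_le_tsum hterm).trans ?_
  rw [← ENNReal.ofReal_tsum_of_nonneg (fun k => by positivity)
    ((summable_geometric_of_lt_one hq0.le hq1).mul_left _)]
  apply ENNReal.ofReal_le_ofReal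
  rw [tsum_mul_left, tsum_geometric_of_lt_one hq0.le hq1]
  apply le_of_eq; ring

/-- Near part. -/
lemma near_part (N : ℕ) (hN : 3 ≤ N) (α : ℝ) (hα0 : 0 < α) (hα2 : α < 2) :
    ∃ C : ℝ, 0 < C ∧ ∀ (x : EN N), ∀ e : ℝ, 0 < e →
    ∫⁻ y, (ball x e).indicator
      (fun y => ENNReal.ofReal (‖x - y‖ ^ (α - (N : ℝ)))) y
      ≤ ENNReal.ofReal (C * e ^ α) := by
  have h3 : (3 : ℝ) ≤ N := by exact_mod_cast hN
  set v := (volume (ball (0 : EN N) 1)).toReal with hvdef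
  have hv : 0 < v := aux_volpos N
  set q : ℝ := (1 / 2) ^ α with hq
  have hq0 : 0 < q := by positivity
  have hq1 : q < 1 := Real.rpow_lt_one (by norm_num) (by norm_num) hα0
  have hq2 : 0 < 1 - q := by linarith
  refine ⟨(1 / 2) ^ (α - N) * 2 ^ N * v * (1 - q)⁻¹, by positivity, fun x e he => ?_⟩
  have hpt : ∀ y, (ball x e).indicator
      (fun y => ENNReal.ofReal (‖x - y‖ ^ (α - (N : ℝ)))) y ≤
      ∑' k : ℕ, (ball x (2 * ((1 / 2) ^ k * e))).indicator
        (fun _ => ENNReal.ofReal ((1 / 2 * ((1 / 2) ^ k * e)) ^ (α - (N : ℝ)))) y := by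
    intro y
    by_cases hy : y ∈ ball x e
    · rw [Set.indicator_of_mem hy]
      rw [mem_ball_iff_norm, norm_sub_rev] at hy
      rcases (norm_nonneg (x - y)).eq_or_lt with h0 | h0
      · rw [← h0, Real.zero_rpow (by linarith)]; simp
      obtain ⟨k, hk1, hk2⟩ := exists_nat_pow_near_of_lt_one (div_pos h0 he)
        ((div_le_one he).2 hy.le) (show (0 : ℝ) < 1 / 2 by norm_num) (by norm_num)
      rw [div_le_iff₀ he] at hk2
      rw [lt_div_iff₀ he] at hk1
      refine le_trans ?_ (ENNReal.le_tsum k)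
      have hp : (0 : ℝ) < (1 / 2) ^ k * e := by positivity
      rw [Set.indicator_of_mem (by rw [mem_ball_iff_norm, norm_sub_rev]; linarith)]
      apply ENNReal.ofReal_le_ofReal
      apply Real.rpow_le_rpow_of_nonpos (by positivity) _ (by linarith)
      refine le_trans (le_of_eq ?_) hk1.le
      ring
    · rw [Set.indicator_of_notMem hy]; exact zero_le
  refine (lintegral_mono hpt).trans ?_
  rw [lintegral_tsum (fun k => (measurable_const.indicator measurableSet_ball).aemeasurable)]
  have hterm : ∀ k : ℕ, ∫⁻ y, (ball x (2 * ((1 / 2) ^ k * e))).indicator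
        (fun _ => ENNReal.ofReal ((1 / 2 * ((1 / 2) ^ k * e)) ^ (α - (N : ℝ)))) y ≤
      ENNReal.ofReal ((1 / 2) ^ (α - N) * 2 ^ N * v * e ^ α * q ^ k) := by
    intro k
    rw [lintegral_indicator measurableSet_ball, setLIntegral_const,
      aux_vol N hN x _ (by positivity), ← ENNReal.ofReal_mul (by positivity)]
    apply ENNReal.ofReal_le_ofReal
    apply le_of_eq
    have hp : (0 : ℝ) < (1 / 2) ^ k * e := by positivity
    rw [Real.mul_rpow (by norm_num) hp.le, mul_pow]
    have h4 : ((1 / 2) ^ k * e : ℝ) ^ (α - (N : ℝ)) * ((1 / 2) ^ k * e : ℝ) ^ N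
        = q ^ k * e ^ α := by
      rw [← Real.rpow_natCast _ N, ← Real.rpow_add hp, show α - (N : ℝ) + N = α by ring,
        Real.mul_rpow (by positivity) he.le, hq, ← Real.rpow_natCast, ← Real.rpow_natCast,
              ← Real.rpow_mul (by norm_num), ← Real.rpow_mul (by norm_num), mul_comm (k : ℝ)]
    linear_combination ((1 / 2) ^ (α - (N:ℝ)) * 2 ^ N * v) * h4
  refine (ENNReal.tsum_le_tsum hterm).trans ?_
  rw [← ENNReal.ofReal_tsum_of_nonneg (fun k => by positivity)
    ((summable_geometric_of_lt_one hq0.le hq1).mul_left _)]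
  apply ENNReal.ofReal_le_ofReal
  rw [tsum_mul_left, tsum_geometric_of_lt_one hq0.le hq1]
  apply le_of_eq; ring

/-- The integrand in the Green function. -/
def gfun (N : ℕ) (α s : ℝ) : ℝ := s ^ (α / 2 - 1) * (1 + s) ^ (-(N : ℝ) / 2)

lemma gfun_nonneg (N : ℕ) (α s : ℝ) (hs : 0 < s) : 0 ≤ gfun N α s := by
  unfold gfun; positivity

lemma gfun_meas (N : ℕ) (α : ℝ) : Measurable (gfun N α) := by
  unfold gfun; fun_prop

lemma gfun_le (N : ℕ) (α s : ℝ) (hs : 0 < s) : gfun N α s ≤ s ^ (α / 2 - 1) := by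
  unfold gfun
  apply mul_le_of_le_one_right (by positivity)
  apply Real.rpow_le_one_of_one_le_of_nonpos (by linarith)
  have : (0 : ℝ) ≤ N := by positivity
  linarith

lemma gfun_int (N : ℕ) (hN : 3 ≤ N) (α : ℝ) (hα0 : 0 < α) (hα2 : α < 2) :
    IntegrableOn (gfun N α) (Ioi 0) := by
  have h3 : (3 : ℝ) ≤ N := by exact_mod_cast hN
  rw [← Ioc_union_Ioi_eq_Ioi (zero_le_one (α := ℝ))]
  apply IntegrableOn.union
  · have := intervalIntegral.intervalIntegrable_rpow' (a := 0) (b := 1) (r := α / 2 - 1)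
      (by linarith)
    rw [intervalIntegrable_iff_integrableOn_Ioc_of_le zero_le_one] at this
    refine Integrable.mono' this (gfun_meas N α).aestronglyMeasurable ?_
    filter_upwards [ae_restrict_mem measurableSet_Ioc] with s hs
    rw [Real.norm_of_nonneg (gfun_nonneg N α s hs.1)]
    exact gfun_le N α s hs.1
  · have := integrableOn_Ioi_rpow_of_lt (a := α / 2 - 1 - N / 2) (c := 1) (by linarith) one_pos
    refine Integrable.mono' this (gfun_meas N α).aestronglyMeasurable ?_
    filter_upwards [ae_restrict_mem measurableSet_Ioi] with s hs
    have hs1 : (1 : ℝ) < s := hs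
    have hs0 : 0 < s := by linarith
    rw [Real.norm_of_nonneg (gfun_nonneg N α s hs0)]
    unfold gfun
    rw [show α / 2 - 1 - (N : ℝ) / 2 = (α / 2 - 1) + (-(N : ℝ) / 2) by ring, Real.rpow_add hs0]
    apply mul_le_mul_of_nonneg_left _ (by positivity)
    exact Real.rpow_le_rpow_of_nonpos hs0 (by linarith) (by linarith)

/-- Primitive of the integrand, extended by zero to the left. -/
def phi (N : ℕ) (α r : ℝ) : ℝ := ∫ s in Ioc 0 r, gfun N α s

lemma phi_mono (N : ℕ) (hN : 3 ≤ N) (α : ℝ) (hα0 : 0 < α) (hα2 : α < 2) :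
    Monotone (phi N α) := by
  intro a b hab
  unfold phi
  apply setIntegral_mono_set ((gfun_int N hN α hα0 hα2).mono_set Ioc_subset_Ioi_self)
  · filter_upwards [ae_restrict_mem measurableSet_Ioc] with s hs
    exact gfun_nonneg N α s hs.1
  · exact (Ioc_subset_Ioc_right hab).eventuallyLE

lemma phi_nonneg (N : ℕ) (α r : ℝ) : 0 ≤ phi N α r :=
  setIntegral_nonneg measurableSet_Ioc (fun s hs => gfun_nonneg N α s hs.1)

lemma phi_bdd (N : ℕ) (hN : 3 ≤ N) (α : ℝ) (hα0 : 0 < α) (hα2 : α < 2) (r : ℝ) :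
    phi N α r ≤ ∫ s in Ioi 0, gfun N α s := by
  unfold phi
  apply setIntegral_mono_set (gfun_int N hN α hα0 hα2)
  · filter_upwards [ae_restrict_mem measurableSet_Ioi] with s hs
    exact gfun_nonneg N α s hs
  · exact Ioc_subset_Ioi_self.eventuallyLE

lemma phi_le (N : ℕ) (hN : 3 ≤ N) (α : ℝ) (hα0 : 0 < α) (hα2 : α < 2) (r : ℝ) (hr : 0 ≤ r) :
    phi N α r ≤ 2 / α * r ^ (α / 2) := by
  have hi := intervalIntegral.intervalIntegrable_rpow' (a := 0) (b := r) (r := α / 2 - 1)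
      (by linarith)
  rw [intervalIntegrable_iff_integrableOn_Ioc_of_le hr] at hi
  calc phi N α r ≤ ∫ s in Ioc 0 r, s ^ (α / 2 - 1) := by
        unfold phi
        apply setIntegral_mono_on ((gfun_int N hN α hα0 hα2).mono_set Ioc_subset_Ioi_self) hi
          measurableSet_Ioc
        intro s hs
        exact gfun_le N α s hs.1
    _ = _ := by
        rw [← intervalIntegral.integral_of_le hr, integral_rpow (Or.inl (by linarith)),
          Real.zero_rpow (by linarith)]
        rw [show α / 2 - 1 + 1 = α / 2 by ring]
        field_simp
        ring

lemma phi_pos (N : ℕ) (hN : 3 ≤ N) (α : ℝ) (hα0 : 0 < α) (hα2 : α < 2) : 0 < phi N α 1 := by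
  unfold phi
  rw [← intervalIntegral.integral_of_le zero_le_one]
  apply intervalIntegral.intervalIntegral_pos_of_pos_on
  · rw [intervalIntegrable_iff_integrableOn_Ioc_of_le zero_le_one]
    exact (gfun_int N hN α hα0 hα2).mono_set Ioc_subset_Ioi_self
  · intro s hs
    have := hs.1
    unfold gfun; positivity
  · exact one_pos

lemma green_eq (N : ℕ) (α : ℝ) (x y : EN N) (hx : ‖x‖ < 1) (hy : ‖y‖ < 1) :
    greenB N α x y = greenCoeff N α * ‖x - y‖ ^ (α - (N : ℝ)) *
      phi N α ((1 - ‖x‖ ^ 2) * (1 - ‖y‖ ^ 2) / ‖x - y‖ ^ 2) := by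
  unfold greenB phi
  rw [if_pos ⟨hx, hy⟩, intervalIntegral.integral_of_le]
  · rfl
  · have h1 : 0 ≤ 1 - ‖x‖ ^ 2 := by nlinarith [norm_nonneg x]
    have h2 : 0 ≤ 1 - ‖y‖ ^ 2 := by nlinarith [norm_nonneg y]
    positivity

lemma greenCoeff_pos (N : ℕ) (hN : 3 ≤ N) (α : ℝ) (hα0 : 0 < α) : 0 < greenCoeff N α := by
  have h3 : (3 : ℝ) ≤ N := by exact_mod_cast hN
  unfold greenCoeff
  have h1 := Real.Gamma_pos_of_pos (show 0 < (N : ℝ) / 2 by linarith)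
  have h2 := Real.Gamma_pos_of_pos (show 0 < α / 2 by linarith)
  have := Real.pi_pos
  positivity

/-- The explicit integrand. -/
def ffun (N : ℕ) (α lam : ℝ) (x y : EN N) : ℝ :=
  greenCoeff N α * ‖x - y‖ ^ (α - (N : ℝ)) *
      phi N α ((1 - ‖x‖ ^ 2) * (1 - ‖y‖ ^ 2) / ‖x - y‖ ^ 2) * (1 - ‖y‖) ^ (-lam)

lemma ffun_meas (N : ℕ) (hN : 3 ≤ N) (α : ℝ) (hα0 : 0 < α) (hα2 : α < 2) (lam : ℝ) (x : EN N) :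
    Measurable (ffun N α lam x) := by
  unfold ffun
  have h1 := (phi_mono N hN α hα0 hα2).measurable
  have h2 : Measurable (fun y : EN N => (1 - ‖x‖ ^ 2) * (1 - ‖y‖ ^ 2) / ‖x - y‖ ^ 2) := by
    fun_prop
  have h3 := h1.comp h2
  have h4 : Measurable (fun y : EN N => greenCoeff N α * ‖x - y‖ ^ (α - (N : ℝ))) := by fun_prop
  have h5 : Measurable (fun y : EN N => (1 - ‖y‖) ^ (-lam)) := by fun_prop
  exact (h4.mul h3).mul h5

lemma ffun_nonneg (N : ℕ) (hN : 3 ≤ N) (α : ℝ) (hα0 : 0 < α) (lam : ℝ) (x y : EN N)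
    (hy : ‖y‖ < 1) : 0 ≤ ffun N α lam x y := by
  unfold ffun
  have h1 := greenCoeff_pos N hN α hα0
  have h2 := phi_nonneg N α ((1 - ‖x‖ ^ 2) * (1 - ‖y‖ ^ 2) / ‖x - y‖ ^ 2)
  have h3 : 0 ≤ (1 - ‖y‖) ^ (-lam) := Real.rpow_nonneg (by linarith) _
  positivity

lemma norm_near (N : ℕ) (x y : EN N) (h : y ∈ ball x ((1 - ‖x‖) / 2)) :
    (1 - ‖x‖) / 2 ≤ 1 - ‖y‖ ∧ 1 - ‖y‖ ≤ 3 * ((1 - ‖x‖) / 2) := by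
  rw [mem_ball_iff_norm] at h
  have h1 := norm_sub_norm_le y x
  have h2 := norm_sub_norm_le x y
  rw [norm_sub_rev] at h2
  constructor <;> linarith

lemma ffun_near (N : ℕ) (hN : 3 ≤ N) (α : ℝ) (hα0 : 0 < α) (hα2 : α < 2) (lam : ℝ)
    (hl : 0 < lam) (x y : EN N) (hx : ‖x‖ < 1) (h : y ∈ ball x ((1 - ‖x‖) / 2)) :
    ffun N α lam x y ≤ (greenCoeff N α * (∫ s in Ioi 0, gfun N α s) * ((1 - ‖x‖) / 2) ^ (-lam)) *
      ‖x - y‖ ^ (α - (N : ℝ)) := by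
  obtain ⟨h1, -⟩ := norm_near N x y h
  have hk := greenCoeff_pos N hN α hα0
  have h2 := phi_bdd N hN α hα0 hα2 ((1 - ‖x‖ ^ 2) * (1 - ‖y‖ ^ 2) / ‖x - y‖ ^ 2)
  have h0 := phi_nonneg N α ((1 - ‖x‖ ^ 2) * (1 - ‖y‖ ^ 2) / ‖x - y‖ ^ 2)
  have h3 : (1 - ‖y‖) ^ (-lam) ≤ ((1 - ‖x‖) / 2) ^ (-lam) :=
    Real.rpow_le_rpow_of_nonpos (by linarith) h1 (by linarith)
  have h4 : 0 ≤ (1 - ‖y‖) ^ (-lam) := Real.rpow_nonneg (by linarith) _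
  unfold ffun
  calc _ ≤ greenCoeff N α * ‖x - y‖ ^ (α - (N : ℝ)) * (∫ s in Ioi 0, gfun N α s) *
        ((1 - ‖x‖) / 2) ^ (-lam) := by
        apply mul_le_mul _ h3 h4
        · have := h0.trans h2
          positivity
        · exact mul_le_mul_of_nonneg_left h2 (by positivity)
    _ = _ := by ring

lemma ffun_far (N : ℕ) (hN : 3 ≤ N) (α : ℝ) (hα0 : 0 < α) (hα2 : α < 2) (lam : ℝ)
    (x y : EN N) (hx : ‖x‖ < 1) (hy : ‖y‖ < 1) (hne : 0 < ‖x - y‖) :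
    ffun N α lam x y ≤ (greenCoeff N α * (2 / α) * 4 ^ (α / 2) * (1 - ‖x‖) ^ (α / 2)) *
      ((1 - ‖y‖) ^ (-(lam - α / 2)) * ‖x - y‖ ^ (-(N : ℝ))) := by
  have hk := greenCoeff_pos N hN α hα0
  have hx0 := norm_nonneg x
  have hy0 := norm_nonneg y
  have hdx : 0 < 1 - ‖x‖ := by linarith
  have hdy : 0 < 1 - ‖y‖ := by linarith
  set ρ := ‖x - y‖
  have a1 : 0 ≤ 1 - ‖x‖ ^ 2 := by nlinarith
  have a2 : 0 ≤ 1 - ‖y‖ ^ 2 := by nlinarith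
  have hr0 : 0 ≤ (1 - ‖x‖ ^ 2) * (1 - ‖y‖ ^ 2) / ρ ^ 2 := by positivity
  have hr : (1 - ‖x‖ ^ 2) * (1 - ‖y‖ ^ 2) / ρ ^ 2 ≤ 4 * (1 - ‖x‖) * (1 - ‖y‖) / ρ ^ 2 := by
    apply div_le_div_of_nonneg_right _ (by positivity)
    have b1 : 1 - ‖x‖ ^ 2 ≤ 2 * (1 - ‖x‖) := by nlinarith
    have b2 : 1 - ‖y‖ ^ 2 ≤ 2 * (1 - ‖y‖) := by nlinarith
    calc _ ≤ (2 * (1 - ‖x‖)) * (2 * (1 - ‖y‖)) := mul_le_mul b1 b2 a2 (by positivity)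
      _ = _ := by ring
  have h1 := phi_le N hN α hα0 hα2 _ hr0
  have h2 := Real.rpow_le_rpow hr0 hr (show 0 ≤ α / 2 by linarith)
  have h3 : (4 * (1 - ‖x‖) * (1 - ‖y‖) / ρ ^ 2) ^ (α / 2) =
      4 ^ (α / 2) * (1 - ‖x‖) ^ (α / 2) * (1 - ‖y‖) ^ (α / 2) * ρ ^ (-α) := by
    rw [Real.div_rpow (by positivity) (by positivity), Real.mul_rpow (by positivity) hdy.le,
      Real.mul_rpow (by positivity) hdx.le, Real.rpow_neg hne.le, div_eq_mul_inv,
      ← Real.rpow_natCast ρ 2, ← Real.rpow_mul hne.le]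
    congr 3
    push_cast; ring
  rw [h3] at h2
  unfold ffun
  calc _ ≤ greenCoeff N α * ρ ^ (α - (N : ℝ)) * (2 / α *
        (4 ^ (α / 2) * (1 - ‖x‖) ^ (α / 2) * (1 - ‖y‖) ^ (α / 2) * ρ ^ (-α))) *
        (1 - ‖y‖) ^ (-lam) := by
        apply mul_le_mul_of_nonneg_right _ (by positivity)
        apply mul_le_mul_of_nonneg_left _ (by positivity)
        exact h1.trans (mul_le_mul_of_nonneg_left h2 (by positivity))
    _ = _ := by
        have e1 : ρ ^ (-(N : ℝ)) = ρ ^ (α - (N : ℝ)) * ρ ^ (-α) := by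
          rw [← Real.rpow_add hne]; congr 1; ring
        have e2 : (1 - ‖y‖) ^ (-(lam - α / 2)) = (1 - ‖y‖) ^ (α / 2) * (1 - ‖y‖) ^ (-lam) := by
          rw [← Real.rpow_add hdy]; congr 1; ring
        rw [e1, e2]; ring

lemma ffun_lower (N : ℕ) (hN : 3 ≤ N) (α : ℝ) (hα0 : 0 < α) (hα2 : α < 2) (lam : ℝ)
    (hl : 0 < lam) (x y : EN N) (hx : ‖x‖ < 1) (h : y ∈ ball x ((1 - ‖x‖) / 2)) (hne : y ≠ x) :
    greenCoeff N α * ((1 - ‖x‖) / 2) ^ (α - (N : ℝ)) * phi N α 1 *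
      (3 * ((1 - ‖x‖) / 2)) ^ (-lam) ≤ ffun N α lam x y := by
  have h3 : (3 : ℝ) ≤ N := by exact_mod_cast hN
  obtain ⟨h1, h2⟩ := norm_near N x y h
  have hx0 := norm_nonneg x
  have hy0 := norm_nonneg y
  have hk := greenCoeff_pos N hN α hα0
  have hp := phi_pos N hN α hα0 hα2
  rw [mem_ball_iff_norm, norm_sub_rev] at h
  have hρ : 0 < ‖x - y‖ := by rw [norm_pos_iff, sub_ne_zero]; exact hne.symm
  set ρ := ‖x - y‖
  have hr : 1 ≤ (1 - ‖x‖ ^ 2) * (1 - ‖y‖ ^ 2) / ρ ^ 2 := by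
    rw [one_le_div (by positivity)]
    have b1 : (1 - ‖x‖) / 2 ≤ 1 - ‖x‖ ^ 2 := by nlinarith
    have b2 : (1 - ‖x‖) / 2 ≤ 1 - ‖y‖ ^ 2 := by nlinarith
    calc ρ ^ 2 = ρ * ρ := by ring
      _ ≤ ((1 - ‖x‖) / 2) * ((1 - ‖x‖) / 2) := mul_le_mul h.le h.le hρ.le (by linarith)
      _ ≤ _ := mul_le_mul b1 b2 (by linarith) (by nlinarith)
  unfold ffun
  have c1 := phi_mono N hN α hα0 hα2 hr
  have c2 : ((1 - ‖x‖) / 2) ^ (α - (N : ℝ)) ≤ ρ ^ (α - (N : ℝ)) :=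
    Real.rpow_le_rpow_of_nonpos hρ h.le (by linarith)
  have c3 : (3 * ((1 - ‖x‖) / 2)) ^ (-lam) ≤ (1 - ‖y‖) ^ (-lam) :=
    Real.rpow_le_rpow_of_nonpos (by linarith) h2 (by linarith)
  have hd : 0 < (1 - ‖x‖) / 2 := by linarith
  have c4 := hp.le.trans c1
  gcongr

/-- Upper bound as a lower Lebesgue integral. -/
lemma upper (N : ℕ) (hN : 3 ≤ N) (α : ℝ) (hα0 : 0 < α) (hα2 : α < 2)
    (lam : ℝ) (hlam1 : α / 2 < lam) (hlam2 : lam < 1 + α / 2) :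
    ∃ C : ℝ, 0 < C ∧ ∀ x : EN N, ‖x‖ < 1 →
      ∫⁻ y in ball (0 : EN N) 1, ENNReal.ofReal (ffun N α lam x y) ≤
        ENNReal.ofReal (C * (1 - ‖x‖) ^ (α - lam)) := by
  obtain ⟨C1, hC1, hnear⟩ := near_part N hN α hα0 hα2
  obtain ⟨C2, hC2, hfar⟩ := far_part N hN (lam - α / 2) (by linarith) (by linarith)
  have hk := greenCoeff_pos N hN α hα0
  set M := ∫ s in Ioi 0, gfun N α s with hM
  have hM0 : 0 < M := (phi_pos N hN α hα0 hα2).trans_le (phi_bdd N hN α hα0 hα2 1)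
  refine ⟨(greenCoeff N α * M * C1 + greenCoeff N α * (2 / α) * 4 ^ (α / 2) * 2 ^ (α / 2) * C2) *
    (1 / 2) ^ (α - lam), by positivity, fun x hx => ?_⟩
  have hd : 0 < 1 - ‖x‖ := by linarith
  set d := 1 - ‖x‖ with hddef
  set e := d / 2 with he
  have he0 : 0 < e := by positivity
  set A := greenCoeff N α * M * e ^ (-lam) with hA
  set A' := greenCoeff N α * (2 / α) * 4 ^ (α / 2) * d ^ (α / 2) with hA'
  have hA0 : 0 ≤ A := by positivity
  have hA'0 : 0 ≤ A' := by positivity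
  rw [← lintegral_indicator measurableSet_ball]
  have hpt : ∀ y, (ball (0 : EN N) 1).indicator (fun y => ENNReal.ofReal (ffun N α lam x y)) y ≤
      ENNReal.ofReal A * (ball x e).indicator
        (fun y => ENNReal.ofReal (‖x - y‖ ^ (α - (N : ℝ)))) y +
      ENNReal.ofReal A' * (ball (0 : EN N) 1 \ ball x e).indicator
        (fun y => ENNReal.ofReal ((1 - ‖y‖) ^ (-(lam - α / 2)) * ‖x - y‖ ^ (-(N : ℝ)))) y := by
    intro y
    by_cases hy : y ∈ ball (0 : EN N) 1
    · rw [Set.indicator_of_mem hy]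
      have hy' := hy
      rw [mem_ball_zero_iff] at hy'
      by_cases hye : y ∈ ball x e
      · refine le_trans ?_ le_self_add
        rw [Set.indicator_of_mem hye, ← ENNReal.ofReal_mul hA0]
        apply ENNReal.ofReal_le_ofReal
        exact ffun_near N hN α hα0 hα2 lam (by linarith) x y hx hye
      · refine le_trans ?_ le_add_self
        rw [Set.indicator_of_mem (show y ∈ ball (0 : EN N) 1 \ ball x e from ⟨hy, hye⟩),
          ← ENNReal.ofReal_mul hA'0]
        apply ENNReal.ofReal_le_ofReal
        apply ffun_far N hN α hα0 hα2 lam x y hx hy'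
        rw [mem_ball_iff_norm, not_lt, norm_sub_rev] at hye
        linarith
    · rw [Set.indicator_of_notMem hy]; exact zero_le
  refine (lintegral_mono hpt).trans ?_
  have m1 : Measurable ((ball x e).indicator
        (fun y => ENNReal.ofReal (‖x - y‖ ^ (α - (N : ℝ))))) := by
    apply Measurable.indicator _ measurableSet_ball
    fun_prop
  have m2 : Measurable ((ball (0 : EN N) 1 \ ball x e).indicator
        (fun y => ENNReal.ofReal ((1 - ‖y‖) ^ (-(lam - α / 2)) * ‖x - y‖ ^ (-(N : ℝ))))) := by
    apply Measurable.indicator _ (measurableSet_ball.diff measurableSet_ball)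
    fun_prop
  rw [lintegral_add_left (m1.const_mul _), lintegral_const_mul _ m1, lintegral_const_mul _ m2]
  calc _ ≤ ENNReal.ofReal A * ENNReal.ofReal (C1 * e ^ α) +
        ENNReal.ofReal A' * ENNReal.ofReal (C2 * e ^ (-(lam - α / 2))) := by
        gcongr
        · exact hnear x e he0
        · exact hfar x hx e he0
    _ = _ := by
        rw [← ENNReal.ofReal_mul hA0, ← ENNReal.ofReal_mul hA'0,
          ← ENNReal.ofReal_add (by positivity) (by positivity)]
        congr 1
        have e0 : (1 / 2) ^ (α - lam) * d ^ (α - lam) = e ^ (α - lam) := by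
          rw [← Real.mul_rpow (by norm_num) hd.le, he]; congr 1; ring
        have e1 : e ^ (α - lam) = e ^ (-lam) * e ^ α := by
          rw [← Real.rpow_add he0]; congr 1; ring
        have e2 : d ^ (α / 2) = 2 ^ (α / 2) * e ^ (α / 2) := by
          rw [← Real.mul_rpow (by norm_num) he0.le, he]; congr 1; ring
        have e3 : e ^ (α - lam) = e ^ (α / 2) * e ^ (-(lam - α / 2)) := by
          rw [← Real.rpow_add he0]; congr 1; ring
        rw [mul_assoc _ _ (d ^ (α - lam)), e0, add_mul, hA, hA', e2]
        congr 1
        · rw [e1]; ring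
        · rw [e3]; ring

/-- `G_B^α(δ^{-λ}) ≈ δ^{α-λ}` for `α/2 < λ < 1 + α/2`. -/
theorem statement_4 (N : ℕ) (hN : 3 ≤ N) (α : ℝ) (hα0 : 0 < α) (hα2 : α < 2)
    (lam : ℝ) (hlam1 : α / 2 < lam) (hlam2 : lam < 1 + α / 2) :
    ∃ c₁ c₂ : ℝ, 0 < c₁ ∧ c₁ ≤ c₂ ∧
      ∀ x : EN N, ‖x‖ < 1 →
        c₁ * delta1 x ^ (α - lam) ≤
            (∫ y in Metric.ball (0 : EN N) 1, greenB N α x y * delta1 y ^ (-lam)) ∧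
        (∫ y in Metric.ball (0 : EN N) 1, greenB N α x y * delta1 y ^ (-lam)) ≤
            c₂ * delta1 x ^ (α - lam) := by
  obtain ⟨C, hC, hup⟩ := upper N hN α hα0 hα2 lam hlam1 hlam2
  have hk := greenCoeff_pos N hN α hα0
  have hp := phi_pos N hN α hα0 hα2
  set v := (volume (ball (0 : EN N) 1)).toReal with hv
  have hv0 : 0 < v := aux_volpos N
  set c : ℝ := greenCoeff N α * phi N α 1 * 3 ^ (-lam) * v * (1 / 2) ^ (α - lam) with hc
  have hc0 : 0 < c := by positivity
  refine ⟨c, max c C, hc0, le_max_left _ _, fun x hx => ?_⟩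
  have hd : 0 < 1 - ‖x‖ := by linarith
  have hdelta : delta1 x = 1 - ‖x‖ := by unfold delta1; rw [if_pos hx]
  have hint : (∫ y in Metric.ball (0 : EN N) 1, greenB N α x y * delta1 y ^ (-lam)) =
      ∫ y in Metric.ball (0 : EN N) 1, ffun N α lam x y := by
    apply setIntegral_congr_fun measurableSet_ball
    intro y hy
    rw [mem_ball_zero_iff] at hy
    have : delta1 y = 1 - ‖y‖ := by unfold delta1; rw [if_pos hy]
    simp only [ffun, green_eq N α x y hx hy, this]
  rw [hint, hdelta]
  have hmeas := ffun_meas N hN α hα0 hα2 lam x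
  have hnn : 0 ≤ᵐ[volume.restrict (ball (0 : EN N) 1)] ffun N α lam x := by
    filter_upwards [ae_restrict_mem measurableSet_ball] with y hy
    rw [mem_ball_zero_iff] at hy
    exact ffun_nonneg N hN α hα0 lam x y hy
  have hu := hup x hx
  have hI : IntegrableOn (ffun N α lam x) (ball (0 : EN N) 1) := by
    refine ⟨hmeas.aestronglyMeasurable, ?_⟩
    rw [hasFiniteIntegral_iff_ofReal hnn]
    exact hu.trans_lt ENNReal.ofReal_lt_top
  constructor
  · set e := (1 - ‖x‖) / 2 with he
    have he0 : 0 < e := by positivity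
    have hsub : ball x e ⊆ ball (0 : EN N) 1 := by
      intro y hy
      obtain ⟨h1, -⟩ := norm_near N x y hy
      rw [mem_ball_zero_iff]
      linarith
    have : Nontrivial (EN N) := by
      have : Nonempty (Fin N) := ⟨⟨0, by omega⟩⟩
      infer_instance
    calc _ = ∫ y in ball x e, greenCoeff N α * e ^ (α - (N : ℝ)) * phi N α 1 *
            (3 * e) ^ (-lam) := by
          rw [setIntegral_const, Measure.real, aux_vol N hN x e he0.le,
            ENNReal.toReal_ofReal (by positivity), smul_eq_mul, hc]
          have e0 : (1 / 2) ^ (α - lam) * (1 - ‖x‖) ^ (α - lam) = e ^ (α - lam) := by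
            rw [← Real.mul_rpow (by norm_num) hd.le, he]; congr 1; ring
          have e1 : e ^ (α - lam) = e ^ N * e ^ (α - (N : ℝ)) * e ^ (-lam) := by
            rw [← Real.rpow_natCast, ← Real.rpow_add he0, ← Real.rpow_add he0]; congr 1; ring
          rw [mul_assoc _ _ ((1 - ‖x‖) ^ (α - lam)), e0, e1, Real.mul_rpow (by norm_num) he0.le]
          ring
      _ ≤ ∫ y in ball x e, ffun N α lam x y := by
          have hcon : ∀ a : ℝ, IntegrableOn (fun _ : EN N => a) (ball x e) := fun a =>
            integrableOn_const measure_ball_lt_top.ne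
          refine integral_mono_ae (hcon _) (hI.mono_set hsub) ?_
          have hae : ∀ᵐ y ∂(volume : Measure (EN N)), y ≠ x := by
            rw [ae_iff]; simp
          filter_upwards [ae_restrict_mem measurableSet_ball, ae_restrict_of_ae hae] with y h1 h2
          exact ffun_lower N hN α hα0 hα2 lam (by linarith) x y hx h1 h2
      _ ≤ _ := setIntegral_mono_set hI hnn hsub.eventuallyLE
  · rw [integral_eq_lintegral_of_nonneg_ae hnn hmeas.aestronglyMeasurable]
    have hpow : 0 < (1 - ‖x‖) ^ (α - lam) := Real.rpow_pos_of_pos hd _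
    calc _ ≤ C * (1 - ‖x‖) ^ (α - lam) :=
          ENNReal.toReal_le_of_le_ofReal (by positivity) hu
      _ ≤ _ := by gcongr; exact le_max_right _ _

end
end

section
/- Let γ > 0 and let u, v : ℝ^N → [0,∞) be Borel functions in 𝓛_α whose restrictions to the closed unit ball are continuous, and such that ∫_{ℝ^N} u(x) Δ^{α/2}φ(x) dx ≤ ∫_{ℝ^N} u(x)^γ φ(x) dx and ∫_{ℝ^N} v(x) Δ^{α/2}φ(x) dx ≥ ∫_{ℝ^N} v(x)^γ φ(x) dx for every nonnegative φ ∈ C_c^∞(B). If u ≥ v on B^c, then u ≥ v on all of ℝ^N. -/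
open MeasureTheory Real Filter Topology Metric Set

noncomputable section

/-- The second difference. -/
def sdiff2 {N : ℕ} (φ : EN N → ℝ) (y z : EN N) : ℝ := φ (y + z) + φ (y - z) - 2 * φ y

/-- The jump kernel. -/
def kerK (N : ℕ) (α : ℝ) (z : EN N) : ℝ := ‖z‖ ^ (-((N : ℝ) + α))

lemma kerK_nonneg (N : ℕ) (α : ℝ) (z : EN N) : 0 ≤ kerK N α z := by
  unfold kerK; positivity

lemma sdiff2_bound {N : ℕ} (φ : EN N → ℝ) (hφ : ContDiff ℝ (⊤ : ℕ∞) φ)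
    (hc : HasCompactSupport φ) :
    ∃ C : ℝ, 0 ≤ C ∧ ∀ y z, |sdiff2 φ y z| ≤ C * min 1 (‖z‖ ^ 2) := by
  have hd : Differentiable ℝ φ := hφ.differentiable (by simp)
  have h1 : ContDiff ℝ 1 (fderiv ℝ φ) :=
    hφ.fderiv_right (m := 1) (WithTop.coe_le_coe.2 (le_top : (1 + 1 : ℕ∞) ≤ ⊤))
  obtain ⟨L, hL⟩ : ∃ L, LipschitzWith L (fderiv ℝ φ) :=
    h1.lipschitzWith_of_hasCompactSupport (hc.fderiv ℝ) (by simp)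
  obtain ⟨M, hM⟩ := hc.exists_bound_of_continuous hφ.continuous
  have hM0 : 0 ≤ M := (norm_nonneg _).trans (hM 0)
  refine ⟨max (4 * M) (2 * L), by positivity, fun y z => ?_⟩
  have hb1 : |sdiff2 φ y z| ≤ 4 * M := by
    have a1 := abs_le.1 (hM (y + z)); have a2 := abs_le.1 (hM (y - z)); have a3 := abs_le.1 (hM y)
    unfold sdiff2
    rw [abs_le]; constructor <;> linarith [a1.1, a1.2, a2.1, a2.2, a3.1, a3.2]
  have hb2 : |sdiff2 φ y z| ≤ 2 * L * ‖z‖ ^ 2 := by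
    have hder : ∀ x : EN N, HasFDerivAt (fun s => φ (y + s) + φ (y - s))
        (fderiv ℝ φ (y + x) - fderiv ℝ φ (y - x)) x := by
      intro x
      have e1 : HasFDerivAt (fun s => φ (y + s)) (fderiv ℝ φ (y + x)) x := by
        have := (hd (y + x)).hasFDerivAt.comp x ((hasFDerivAt_id x).const_add y)
        convert! this using 1
      have e2 : HasFDerivAt (fun s => φ (y - s)) (-fderiv ℝ φ (y - x)) x := by
        have := (hd (y - x)).hasFDerivAt.comp x ((hasFDerivAt_id x).const_sub y)
        convert! this using 1
        ext v; simp
      rw [sub_eq_add_neg]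
      exact e1.add e2
    have key := (convex_closedBall (0 : EN N) ‖z‖).norm_image_sub_le_of_norm_hasFDerivWithin_le
      (C := 2 * L * ‖z‖) (fun x _ => (hder x).hasFDerivWithinAt) (fun x hx => by
        have := hL.dist_le_mul (y + x) (y - x)
        rw [dist_eq_norm, dist_eq_norm] at this
        refine this.trans ?_
        have hx' : ‖x‖ ≤ ‖z‖ := by simpa using hx
        have : ‖y + x - (y - x)‖ ≤ 2 * ‖x‖ := by
          have : y + x - (y - x) = x + x := by abel
          rw [this]; linarith [norm_add_le x x]
        calc (L : ℝ) * ‖y + x - (y - x)‖ ≤ L * (2 * ‖z‖) := by gcongr; linarith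
          _ = _ := by ring)
      (show (0 : EN N) ∈ closedBall (0 : EN N) ‖z‖ by simp)
      (show z ∈ closedBall (0 : EN N) ‖z‖ by simp)
    simp only [add_zero, sub_zero, Real.norm_eq_abs] at key
    have e : sdiff2 φ y z = φ (y + z) + φ (y - z) - (φ y + φ y) := by unfold sdiff2; ring
    rw [e]; refine key.trans (le_of_eq (by ring))
  rcases min_choice 1 (‖z‖ ^ 2) with h | h <;> rw [h]
  · rw [mul_one]; exact hb1.trans (le_max_left _ _)
  · exact hb2.trans (by gcongr; exact le_max_right _ _)

lemma kerK_integrable (N : ℕ) (hN : 3 ≤ N) (α : ℝ) (hα0 : 0 < α) (hα2 : α < 2) :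
    Integrable (fun z : EN N => min 1 (‖z‖ ^ 2) * kerK N α z) := by
  have : Nonempty (Fin N) := ⟨⟨0, by omega⟩⟩
  have := integrable_fun_norm_addHaar (volume : Measure (EN N))
    (f := fun r : ℝ => min 1 (r ^ 2) * r ^ (-((N : ℝ) + α)))
  unfold kerK
  rw [this]
  have hpow : ∀ r : ℝ, 0 < r → r ^ (N - 1) * r ^ (-((N : ℝ) + α)) = r ^ (-1 - α) := by
    intro r hr
    rw [← Real.rpow_natCast, ← Real.rpow_add hr]
    congr 1
    rw [Nat.cast_sub (by omega)]; push_cast; ring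
  have e : Ioi (0 : ℝ) = Ioo 0 1 ∪ Ici 1 := by
    rw [Ioo_union_Ici_eq_Ioi one_pos]
  have hfr : Module.finrank ℝ (EN N) = N := by simp
  rw [hfr, e]
  refine IntegrableOn.union ?_ ?_
  · have h := (intervalIntegral.integrableOn_Ioo_rpow_iff (s := 1 - α) (one_pos)).2 (by linarith)
    refine h.congr_fun (fun r hr => ?_) measurableSet_Ioo
    have hr0 : 0 < r := hr.1
    have : min 1 (r ^ 2) = r ^ 2 := min_eq_right (by nlinarith [hr.1, hr.2])
    simp only [smul_eq_mul]
    rw [this, mul_left_comm, hpow r hr0, ← Real.rpow_natCast, ← Real.rpow_add hr0]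
    congr 1; push_cast; ring
  · have h : IntegrableOn (fun r : ℝ => r ^ (-1 - α)) (Ici 1) := by
      rw [integrableOn_Ici_iff_integrableOn_Ioi]
      exact integrableOn_Ioi_rpow_of_lt (by linarith) one_pos
    refine h.congr_fun (fun r hr => ?_) measurableSet_Ici
    have hr1 : 1 ≤ r := hr
    have : min 1 (r ^ 2) = 1 := min_eq_left (by nlinarith)
    simp only [smul_eq_mul]
    rw [this, one_mul, hpow r (by linarith)]

lemma kernel_bound (N : ℕ) (α : ℝ) (hα0 : 0 < α) (φ : EN N → ℝ) (hφ : ContDiff ℝ (⊤ : ℕ∞) φ)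
    (hc : HasCompactSupport φ) (hs : tsupport φ ⊆ ball (0 : EN N) 1) :
    ∃ C : ℝ, 0 ≤ C ∧ ∀ y z, |sdiff2 φ y z * kerK N α z| ≤
      C * (1 + ‖y‖) ^ (-((N : ℝ) + α)) *
        (min 1 (‖z‖ ^ 2) * kerK N α z + |φ (y + z)| + |φ (y - z)|) := by
  obtain ⟨C, hC0, hC⟩ := sdiff2_bound φ hφ hc
  have hz : ∀ p : EN N, 1 ≤ ‖p‖ → φ p = 0 := by
    intro p hp
    by_contra h
    have := hs (subset_tsupport φ h)
    simp at this; linarith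
  have hNα : 0 < (N : ℝ) + α := by positivity
  refine ⟨(C + 1) * 3 ^ ((N : ℝ) + α), by positivity, fun y z => ?_⟩
  have hk := kerK_nonneg N α z
  rw [abs_mul, abs_of_nonneg hk]
  have hmin : 0 ≤ min 1 (‖z‖ ^ 2) := by positivity
  by_cases hy : ‖y‖ ≤ 2
  · have h1 : (1 : ℝ) ≤ 3 ^ ((N : ℝ) + α) * (1 + ‖y‖) ^ (-((N : ℝ) + α)) := by
      rw [Real.rpow_neg (by positivity), ← div_eq_mul_inv, one_le_div (by positivity)]
      exact Real.rpow_le_rpow (by positivity) (by linarith) hNα.le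
    calc |sdiff2 φ y z| * kerK N α z ≤ C * min 1 (‖z‖ ^ 2) * kerK N α z := by gcongr; exact hC y z
      _ ≤ (C + 1) * (min 1 (‖z‖ ^ 2) * kerK N α z + |φ (y + z)| + |φ (y - z)|) := by
        have a1 := abs_nonneg (φ (y + z)); have a2 := abs_nonneg (φ (y - z))
        rw [mul_assoc]
        gcongr
        · linarith
        · linarith
      _ = 1 * ((C + 1) * (min 1 (‖z‖ ^ 2) * kerK N α z + |φ (y + z)| + |φ (y - z)|)) := by ring
      _ ≤ (3 ^ ((N : ℝ) + α) * (1 + ‖y‖) ^ (-((N : ℝ) + α))) *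
          ((C + 1) * (min 1 (‖z‖ ^ 2) * kerK N α z + |φ (y + z)| + |φ (y - z)|)) := by
        gcongr
      _ = _ := by ring
  · push Not at hy
    have hφy : φ y = 0 := hz y (by linarith)
    have hs2 : |sdiff2 φ y z| ≤ |φ (y + z)| + |φ (y - z)| := by
      unfold sdiff2; rw [hφy]; simpa using abs_add_le (φ (y + z)) (φ (y - z))
    by_cases hzy : ‖z‖ ≤ ‖y‖ - 1
    · have e1 : φ (y + z) = 0 := hz _ (by
        have := norm_sub_norm_le y (-z); rw [norm_neg, sub_neg_eq_add] at this; linarith)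
      have e2 : φ (y - z) = 0 := hz _ (by
        have := norm_sub_norm_le y z; linarith)
      have : sdiff2 φ y z = 0 := by unfold sdiff2; rw [e1, e2, hφy]; ring
      rw [this]; simp only [abs_zero, zero_mul]; positivity
    · push Not at hzy
      have hz0 : 0 < ‖z‖ := by linarith
      have hkk : kerK N α z ≤ 3 ^ ((N : ℝ) + α) * (1 + ‖y‖) ^ (-((N : ℝ) + α)) := by
        unfold kerK
        rw [Real.rpow_neg (by positivity), Real.rpow_neg (by positivity), ← div_eq_mul_inv,
          ← Real.div_rpow (by positivity) (by positivity), ← Real.inv_rpow (by positivity)]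
        refine Real.rpow_le_rpow (by positivity) ?_ hNα.le
        rw [inv_eq_one_div, div_le_div_iff₀ hz0 (by positivity)]
        linarith
      calc |sdiff2 φ y z| * kerK N α z
          ≤ (|φ (y + z)| + |φ (y - z)|) * (3 ^ ((N : ℝ) + α) * (1 + ‖y‖) ^ (-((N : ℝ) + α))) := by
            gcongr
        _ = 1 * (3 ^ ((N : ℝ) + α) * (1 + ‖y‖) ^ (-((N : ℝ) + α))) *
            (0 + |φ (y + z)| + |φ (y - z)|) := by ring
        _ ≤ (C + 1) * (3 ^ ((N : ℝ) + α) * (1 + ‖y‖) ^ (-((N : ℝ) + α))) *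
            (min 1 (‖z‖ ^ 2) * kerK N α z + |φ (y + z)| + |φ (y - z)|) := by
            gcongr
            · linarith
            · positivity
        _ = _ := by ring

lemma kerK_measurable (N : ℕ) (α : ℝ) : Measurable (kerK N α) := by
  unfold kerK; fun_prop

lemma kerK_neg (N : ℕ) (α : ℝ) (z : EN N) : kerK N α (-z) = kerK N α z := by
  unfold kerK; rw [norm_neg]

lemma sdiff2_integrable (N : ℕ) (hN : 3 ≤ N) (α : ℝ) (hα0 : 0 < α) (hα2 : α < 2)
    (φ : EN N → ℝ) (hφ : ContDiff ℝ (⊤ : ℕ∞) φ) (hc : HasCompactSupport φ) (y : EN N) :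
    Integrable (fun z => sdiff2 φ y z * kerK N α z) := by
  obtain ⟨C, hC0, hC⟩ := sdiff2_bound φ hφ hc
  refine ((kerK_integrable N hN α hα0 hα2).const_mul C).mono' ?_ (Eventually.of_forall fun z => ?_)
  · have h := hφ.continuous
    have h2 : Continuous (fun z => sdiff2 φ y z) := by unfold sdiff2; fun_prop
    exact (h2.measurable.mul (kerK_measurable N α)).aestronglyMeasurable
  · rw [norm_mul, Real.norm_of_nonneg (kerK_nonneg N α z), ← mul_assoc]
    exact mul_le_mul_of_nonneg_right (hC y z) (kerK_nonneg N α z)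

lemma diff_integrableOn (N : ℕ) (hN : 3 ≤ N) (α : ℝ) (hα0 : 0 < α) (hα2 : α < 2)
    (φ : EN N → ℝ) (hφ : ContDiff ℝ (⊤ : ℕ∞) φ) (hc : HasCompactSupport φ) (y : EN N)
    (ε : ℝ) (hε : 0 < ε) :
    IntegrableOn (fun z => (φ (y + z) - φ y) * kerK N α z) {z | ε < ‖z‖} := by
  obtain ⟨M, hM⟩ := hc.exists_bound_of_continuous hφ.continuous
  have hms : MeasurableSet {z : EN N | ε < ‖z‖} := measurableSet_lt measurable_const measurable_norm
  have hM0 : 0 ≤ M := (norm_nonneg _).trans (hM 0)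
  have hm : 0 < min 1 (ε ^ 2) := by positivity
  refine ((kerK_integrable N hN α hα0 hα2).const_mul (2 * M * (min 1 (ε ^ 2))⁻¹)).integrableOn.mono'
    ?_ ((ae_restrict_iff' hms).2 (Eventually.of_forall fun z hz => ?_))
  · have h := hφ.continuous
    have h2 : Continuous (fun z => φ (y + z) - φ y) := by fun_prop
    exact (h2.measurable.mul (kerK_measurable N α)).aestronglyMeasurable
  · have hz' : ε < ‖z‖ := hz
    rw [norm_mul, Real.norm_of_nonneg (kerK_nonneg N α z), ← mul_assoc]
    refine mul_le_mul_of_nonneg_right ?_ (kerK_nonneg N α z)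
    have h1 : ‖φ (y + z) - φ y‖ ≤ 2 * M := (norm_sub_le _ _).trans (by linarith [hM (y + z), hM y])
    refine h1.trans ?_
    have h2 : min 1 (ε ^ 2) ≤ min 1 (‖z‖ ^ 2) := by gcongr
    have h3 : 1 ≤ (min 1 (ε ^ 2))⁻¹ * min 1 (‖z‖ ^ 2) := by
      rw [inv_mul_eq_div, one_le_div hm]; exact h2
    rw [mul_assoc]
    exact le_mul_of_one_le_right (by positivity) h3

lemma trunc_eq (N : ℕ) (hN : 3 ≤ N) (α : ℝ) (hα0 : 0 < α) (hα2 : α < 2)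
    (φ : EN N → ℝ) (hφ : ContDiff ℝ (⊤ : ℕ∞) φ) (hc : HasCompactSupport φ) (y : EN N)
    (ε : ℝ) (hε : 0 < ε) :
    ∫ p in {p : EN N | ε < dist p y}, (φ p - φ y) / dist p y ^ ((N : ℝ) + α) =
      2⁻¹ * ∫ z, {z : EN N | ε < ‖z‖}.indicator (fun z => sdiff2 φ y z * kerK N α z) z := by
  have hms : MeasurableSet {z : EN N | ε < ‖z‖} := measurableSet_lt measurable_const measurable_norm
  have hms' : MeasurableSet {p : EN N | ε < dist p y} :=
    measurableSet_lt measurable_const (by fun_prop)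
  set G : EN N → ℝ := {z : EN N | ε < ‖z‖}.indicator (fun z => (φ (y + z) - φ y) * kerK N α z)
    with hG
  have hGi : Integrable G := (integrable_indicator_iff hms).2
    (diff_integrableOn N hN α hα0 hα2 φ hφ hc y ε hε)
  have e1 : ∫ p in {p : EN N | ε < dist p y}, (φ p - φ y) / dist p y ^ ((N : ℝ) + α)
      = ∫ z, G z := by
    rw [← integral_indicator hms', ← integral_add_left_eq_self _ y]
    congr 1; ext z
    simp only [hG, indicator, mem_ofPred_eq, dist_self_add_left, kerK]
    split_ifs
    · rw [Real.rpow_neg (norm_nonneg _), div_eq_mul_inv]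
    · rfl
  have e2 : ∫ z, G (-z) = ∫ z, G z := integral_neg_eq_self G volume
  have e3 : ∫ z, {z : EN N | ε < ‖z‖}.indicator (fun z => sdiff2 φ y z * kerK N α z) z
      = ∫ z, (G z + G (-z)) := by
    congr 1; ext z
    simp only [hG, indicator, mem_ofPred_eq, norm_neg, kerK_neg, sdiff2]
    split_ifs
    · rw [← sub_eq_add_neg]; ring
    · ring
  rw [e1, e3, integral_add hGi hGi.comp_neg, e2]; ring

lemma hasFracLap_formula (N : ℕ) (hN : 3 ≤ N) (α : ℝ) (hα0 : 0 < α) (hα2 : α < 2)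
    (φ : EN N → ℝ) (hφ : ContDiff ℝ (⊤ : ℕ∞) φ) (hc : HasCompactSupport φ) (y : EN N) :
    HasFracLap N α φ y (fracLapCoeff N α * (2⁻¹ * ∫ z, sdiff2 φ y z * kerK N α z)) := by
  unfold HasFracLap
  refine Tendsto.const_mul _ ?_
  have hI := sdiff2_integrable N hN α hα0 hα2 φ hφ hc y
  have hlim : Tendsto (fun ε : ℝ => ∫ z, {z : EN N | ε < ‖z‖}.indicator
      (fun z => sdiff2 φ y z * kerK N α z) z) (𝓝[>] 0) (𝓝 (∫ z, sdiff2 φ y z * kerK N α z)) := by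
    refine tendsto_integral_filter_of_dominated_convergence
      (fun z => ‖sdiff2 φ y z * kerK N α z‖) ?_ ?_ hI.norm ?_
    · refine Eventually.of_forall fun ε => hI.aestronglyMeasurable.indicator ?_
      exact measurableSet_lt measurable_const measurable_norm
    · exact Eventually.of_forall fun ε => Eventually.of_forall fun z => norm_indicator_le_norm_self _ _
    · refine Eventually.of_forall fun z => ?_
      by_cases hz : z = 0
      · subst hz
        have : sdiff2 φ y 0 = 0 := by simp [sdiff2]; ring
        refine tendsto_const_nhds.congr fun ε => ?_
        simp [indicator, this]
      · have hz' : 0 < ‖z‖ := norm_pos_iff.2 hz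
        refine tendsto_const_nhds.congr' ?_
        filter_upwards [Ioo_mem_nhdsGT hz'] with ε hε
        rw [indicator_of_mem]; exact hε.2
  refine (hlim.const_mul 2⁻¹).congr' ?_
  filter_upwards [self_mem_nhdsWithin] with ε hε
  exact (trunc_eq N hN α hα0 hα2 φ hφ hc y ε hε).symm

lemma fracLap_formula (N : ℕ) (hN : 3 ≤ N) (α : ℝ) (hα0 : 0 < α) (hα2 : α < 2)
    (φ : EN N → ℝ) (hφ : ContDiff ℝ (⊤ : ℕ∞) φ) (hc : HasCompactSupport φ) (y : EN N) :
    fracLap N α φ y = fracLapCoeff N α * (2⁻¹ * ∫ z, sdiff2 φ y z * kerK N α z) := by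
  have h := hasFracLap_formula N hN α hα0 hα2 φ hφ hc y
  have hex : ∃ L, HasFracLap N α φ y L := ⟨_, h⟩
  unfold fracLap
  rw [dif_pos hex]
  exact tendsto_nhds_unique hex.choose_spec h

lemma fracLapCoeff_pos (N : ℕ) (α : ℝ) (hα0 : 0 < α) (hα2 : α < 2) : 0 < fracLapCoeff N α := by
  unfold fracLapCoeff
  have h1 : Real.Gamma (-α / 2) ≠ 0 := by
    refine Real.Gamma_ne_zero fun m hm => ?_
    rcases Nat.eq_zero_or_pos m with h | h
    · subst h; simp at hm; linarith
    · have : (1 : ℝ) ≤ m := by exact_mod_cast h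
      linarith
  have h2 : 0 < Real.Gamma (((N : ℝ) + α) / 2) := Real.Gamma_pos_of_pos (by positivity)
  have := abs_pos.2 h1
  positivity

lemma weight_pos (N : ℕ) (α : ℝ) (y : EN N) : 0 < (1 + ‖y‖) ^ (-((N : ℝ) + α)) := by positivity

lemma weight_continuous (N : ℕ) (s : ℝ) : Continuous (fun y : EN N => (1 + ‖y‖) ^ s) := by
  refine Continuous.rpow_const (by fun_prop) fun y => Or.inl (by positivity)

lemma memLalpha.int {N : ℕ} {α : ℝ} {w : EN N → ℝ} (hw : memLalpha N α w) :
    Integrable (fun y : EN N => w y * (1 + ‖y‖) ^ (-((N : ℝ) + α))) := hw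

lemma memLalpha.locInt {N : ℕ} {α : ℝ} {w : EN N → ℝ} (hw : memLalpha N α w) :
    LocallyIntegrable w := by
  have h := hw.int.locallyIntegrable
  have h2 := (locallyIntegrableOn_univ.2 h).mul_continuousOn
    (weight_continuous N ((N : ℝ) + α)).continuousOn isOpen_univ.isLocallyClosed
  rw [locallyIntegrableOn_univ] at h2
  have e : w = fun x => w x * (1 + ‖x‖) ^ (-((N : ℝ) + α)) * (1 + ‖x‖) ^ ((N : ℝ) + α) := by
    funext y
    rw [mul_assoc, ← Real.rpow_add (by positivity)]; simp
  rw [e]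
  exact h2

lemma prod_integrable (N : ℕ) (hN : 3 ≤ N) (α : ℝ) (hα0 : 0 < α) (hα2 : α < 2)
    (φ : EN N → ℝ) (hφ : ContDiff ℝ (⊤ : ℕ∞) φ) (hc : HasCompactSupport φ)
    (hs : tsupport φ ⊆ ball (0 : EN N) 1) (w : EN N → ℝ) (hw : memLalpha N α w) :
    Integrable (fun p : EN N × EN N => w p.1 * (sdiff2 φ p.1 p.2 * kerK N α p.2))
      (volume.prod volume) := by
  obtain ⟨C, hC0, hC⟩ := kernel_bound N α hα0 φ hφ hc hs
  have hwn : Integrable (fun y => |w y| * (1 + ‖y‖) ^ (-((N : ℝ) + α))) := by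
    refine hw.int.norm.congr (Eventually.of_forall fun y => ?_)
    simp only [norm_mul, Real.norm_eq_abs, abs_of_pos (weight_pos N α y)]
  have hφi : Integrable (fun y => |φ y|) := (hφ.continuous.integrable_of_hasCompactSupport hc).abs
  have i1 := hwn.mul_prod (kerK_integrable N hN α hα0 hα2)
  have i2 := (measurePreserving_prod_add (volume : Measure (EN N)) volume).integrable_comp_of_integrable
    (hwn.mul_prod hφi)
  have i3 := (measurePreserving_prod_sub (volume : Measure (EN N)) volume).integrable_comp_of_integrable
    (hwn.mul_prod hφi.comp_neg)
  refine (((i1.add i2).add i3).const_mul C).mono' ?_ (Eventually.of_forall fun p => ?_)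
  · have h := hφ.continuous
    have h2 : Continuous (fun p : EN N × EN N => sdiff2 φ p.1 p.2) := by unfold sdiff2; fun_prop
    exact hw.locInt.aestronglyMeasurable.comp_fst.mul
      (h2.measurable.mul ((kerK_measurable N α).comp measurable_snd)).aestronglyMeasurable
  · have := mul_le_mul_of_nonneg_left (hC p.1 p.2) (abs_nonneg (w p.1))
    rw [norm_mul, Real.norm_eq_abs, Real.norm_eq_abs]
    refine this.trans (le_of_eq ?_)
    simp [Function.comp]
    ring

lemma integral_fracLap (N : ℕ) (hN : 3 ≤ N) (α : ℝ) (hα0 : 0 < α) (hα2 : α < 2)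
    (φ : EN N → ℝ) (hφ : ContDiff ℝ (⊤ : ℕ∞) φ) (hc : HasCompactSupport φ)
    (hs : tsupport φ ⊆ ball (0 : EN N) 1) (w : EN N → ℝ) (hw : memLalpha N α w) :
    Integrable (fun y => w y * fracLap N α φ y) ∧
    Integrable (fun z => (∫ y, w y * sdiff2 φ y z) * kerK N α z) ∧
    ∫ y, w y * fracLap N α φ y =
      (fracLapCoeff N α * 2⁻¹) * ∫ z, (∫ y, w y * sdiff2 φ y z) * kerK N α z := by
  have P := prod_integrable N hN α hα0 hα2 φ hφ hc hs w hw
  have e1 : ∀ y, w y * fracLap N α φ y = (fracLapCoeff N α * 2⁻¹) *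
      ∫ z, w y * (sdiff2 φ y z * kerK N α z) := by
    intro y
    rw [fracLap_formula N hN α hα0 hα2 φ hφ hc y, integral_const_mul]; ring
  have e2 : ∀ z, (∫ y, w y * sdiff2 φ y z) * kerK N α z =
      ∫ y, w y * (sdiff2 φ y z * kerK N α z) := by
    intro z
    rw [← integral_mul_const]; congr 1; ext y; ring
  simp only [e1, e2]
  refine ⟨P.integral_prod_left.const_mul _, P.integral_prod_right, ?_⟩
  rw [integral_const_mul, integral_integral_swap P]

lemma conv_integrable {N : ℕ} {α : ℝ} {ρ w : EN N → ℝ} (hρ : Continuous ρ)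
    (hρc : HasCompactSupport ρ) (hw : memLalpha N α w) (a : EN N) :
    Integrable (fun y => w y * ρ (a - y)) := by
  have hcont : Continuous (fun y => ρ (a - y)) := hρ.comp (by fun_prop)
  have := hw.locInt.integrable_smul_left_of_hasCompactSupport hcont
    (hρc.comp_homeomorph (Homeomorph.subLeft a))
  refine this.congr (Eventually.of_forall fun y => ?_)
  simp [mul_comm]

/-- The strong maximum principle step. -/
lemma max_step (N : ℕ) (hN : 3 ≤ N) (α : ℝ) (hα0 : 0 < α) (hα2 : α < 2)
    (ρ : EN N → ℝ) (hρ : ContDiff ℝ (⊤ : ℕ∞) ρ) (hρc : HasCompactSupport ρ)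
    (x : EN N) (hs : tsupport (fun y => ρ (x - y)) ⊆ ball (0 : EN N) 1)
    (w : EN N → ℝ) (hw : memLalpha N α w)
    (hmax : ∀ x', ∫ y, w y * ρ (x' - y) ≤ ∫ y, w y * ρ (x - y))
    (hpos : 0 < ∫ y, w y * ρ (x - y))
    (hneg : ∀ x', 3 < ‖x' - x‖ → ∫ y, w y * ρ (x' - y) ≤ 0) :
    ∫ y, w y * fracLap N α (fun y => ρ (x - y)) y < 0 := by
  have : Nonempty (Fin N) := ⟨⟨0, by omega⟩⟩
  set φ : EN N → ℝ := fun y => ρ (x - y) with hφdef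
  have hφ : ContDiff ℝ (⊤ : ℕ∞) φ := hρ.comp (contDiff_const.sub contDiff_id)
  have hcs : ∀ a : EN N, HasCompactSupport (fun y => ρ (a - y)) := fun a =>
    hρc.comp_homeomorph (Homeomorph.subLeft a)
  obtain ⟨-, hi, heq⟩ := integral_fracLap N hN α hα0 hα2 φ hφ (hcs x) hs w hw
  have hcvi := conv_integrable hρ.continuous hρc hw
  have e : ∀ z, ∫ y, w y * sdiff2 φ y z = (∫ y, w y * ρ (x - z - y)) + (∫ y, w y * ρ (x + z - y))
      - 2 * ∫ y, w y * ρ (x - y) := by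
    intro z
    rw [← integral_add (hcvi _) (hcvi _), ← integral_const_mul]
    refine Eq.trans ?_ (integral_sub
      ((hcvi (x - z)).add (hcvi (x + z))) ((hcvi x).const_mul 2))
    congr 1; ext y
    simp only [sdiff2, hφdef]
    rw [show x - (y + z) = x - z - y by abel, show x - (y - z) = x + z - y by abel]
    ring
  have hle : ∀ z, (∫ y, w y * sdiff2 φ y z) * kerK N α z ≤ 0 := by
    intro z
    refine mul_nonpos_of_nonpos_of_nonneg ?_ (kerK_nonneg N α z)
    rw [e]; linarith [hmax (x - z), hmax (x + z)]
  rw [heq]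
  have hcp := fracLapCoeff_pos N α hα0 hα2
  refine mul_neg_of_pos_of_neg (by positivity) ?_
  have hpos2 : 0 < ∫ z, -((∫ y, w y * sdiff2 φ y z) * kerK N α z) := by
    refine (integral_pos_iff_support_of_nonneg (fun z => by simpa using hle z) hi.neg).2 ?_
    refine lt_of_lt_of_le ?_ (measure_mono (s := {z : EN N | 3 < ‖z‖}) ?_)
    · have ho : IsOpen {z : EN N | 3 < ‖z‖} := isOpen_lt continuous_const continuous_norm
      refine ho.measure_pos volume ?_
      obtain ⟨z, hz⟩ := exists_norm_eq (EN N) (show (0 : ℝ) ≤ 4 by norm_num)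
      exact ⟨z, by change 3 < ‖z‖; rw [hz]; norm_num⟩
    · intro z hz
      have hz' : 3 < ‖z‖ := hz
      have hk : 0 < kerK N α z := Real.rpow_pos_of_pos (by linarith) _
      have h1 := hneg (x - z) (by simpa using hz')
      have h2 := hneg (x + z) (by simpa using hz')
      have : ∫ y, w y * sdiff2 φ y z < 0 := by rw [e]; linarith
      exact Function.mem_support.2 (neg_pos.2 (mul_neg_of_neg_of_pos this hk)).ne'
  rw [integral_neg] at hpos2
  linarith

/-- comparison principle between sub- and supersolutions in `B`. -/
theorem statement_6 (N : ℕ) (hN : 3 ≤ N) (α : ℝ) (hα0 : 0 < α) (hα2 : α < 2)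
    (γ : ℝ) (hγ : 0 < γ) (u v : EN N → ℝ)
    (hu0 : ∀ x, 0 ≤ u x) (hv0 : ∀ x, 0 ≤ v x)
    (huL : memLalpha N α u) (hvL : memLalpha N α v)
    (huc : ContinuousOn u (Metric.closedBall (0 : EN N) 1))
    (hvc : ContinuousOn v (Metric.closedBall (0 : EN N) 1))
    (hsub : ∀ φ : EN N → ℝ, ContDiff ℝ (⊤ : ℕ∞) φ → HasCompactSupport φ →
        tsupport φ ⊆ Metric.ball (0 : EN N) 1 → (∀ x, 0 ≤ φ x) →
        ∫ x, u x * fracLap N α φ x ≤ ∫ x, u x ^ γ * φ x)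
    (hsup : ∀ φ : EN N → ℝ, ContDiff ℝ (⊤ : ℕ∞) φ → HasCompactSupport φ →
        tsupport φ ⊆ Metric.ball (0 : EN N) 1 → (∀ x, 0 ≤ φ x) →
        ∫ x, v x ^ γ * φ x ≤ ∫ x, v x * fracLap N α φ x)
    (hbd : ∀ x : EN N, ¬ ‖x‖ < 1 → v x ≤ u x) :
    ∀ x : EN N, v x ≤ u x := by
  intro x1
  by_contra hx1
  push Not at hx1
  set w : EN N → ℝ := fun x => v x - u x with hwdef
  have hwL : memLalpha N α w := by
    refine (hvL.int.sub huL.int).congr (Eventually.of_forall fun y => ?_)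
    simp only [hwdef, Pi.sub_apply]; ring
  have hwout : ∀ x : EN N, 1 ≤ ‖x‖ → w x ≤ 0 := fun x hx => by
    have := hbd x (not_lt.2 hx)
    simp only [hwdef]; linarith
  set wp : EN N → ℝ := fun x => max (w x) 0 with hwpdef
  have hwpout : ∀ x : EN N, 1 ≤ ‖x‖ → wp x = 0 := fun x hx => max_eq_right (hwout x hx)
  have hwpin : ∀ x : EN N, 0 < wp x → ‖x‖ < 1 ∧ w x = wp x := by
    intro x hx
    refine ⟨?_, ?_⟩
    · by_contra h
      rw [hwpout x (not_lt.1 h)] at hx; exact lt_irrefl _ hx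
    · rcases max_choice (w x) 0 with h | h
      · exact h.symm
      · have : wp x = 0 := h
        linarith
  have hwpc : Continuous wp := by
    have h1 : ContinuousOn wp (closedBall (0 : EN N) 1) :=
      (hvc.sub huc).sup continuousOn_const
    have hcl : IsClosed {x : EN N | 1 ≤ ‖x‖} := isClosed_le continuous_const continuous_norm
    have h2 : ContinuousOn wp {x : EN N | 1 ≤ ‖x‖} :=
      (continuousOn_const (c := (0 : ℝ))).congr fun x hx => hwpout x hx
    have h3 := h1.union_of_isClosed h2 isClosed_closedBall hcl
    rw [← continuousOn_univ]
    refine h3.mono fun x _ => ?_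
    rcases le_total ‖x‖ 1 with h | h
    · left; simpa using h
    · right; exact h
  have hwpcs : HasCompactSupport wp := by
    refine HasCompactSupport.intro (isCompact_closedBall (0 : EN N) 1) fun x hx => ?_
    refine hwpout x ?_
    simp at hx; exact hx.le
  have huni : UniformContinuous wp := hwpcs.uniformContinuous_of_continuous hwpc
  obtain ⟨x0, -, hx0⟩ := (isCompact_closedBall (0 : EN N) 1).exists_isMaxOn ⟨0, by simp⟩
    hwpc.continuousOn
  have hx1p : 0 < wp x1 := lt_max_of_lt_left (by simp only [hwdef]; linarith)
  have hMx : ∀ x, wp x ≤ wp x0 := by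
    have h1 : wp x1 ≤ wp x0 := hx0 (by simpa using (hwpin x1 hx1p).1.le)
    intro x
    rcases le_total ‖x‖ 1 with h | h
    · exact hx0 (by simpa using h)
    · rw [hwpout x h]; linarith
  set M : ℝ := wp x0 with hM
  have hMpos : 0 < M := hx1p.trans_le (hMx x1)
  obtain ⟨d, hd, hdist⟩ := Metric.uniformContinuous_iff.1 huni (M / 8) (by positivity)
  set r : ℝ := min (d / 2) (1 / 2) with hr
  have hr0 : 0 < r := by positivity
  have hrd : r < d := (min_le_left _ _).trans_lt (by linarith)
  have hr1 : r ≤ 1 / 2 := min_le_right _ _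
  have hclose : ∀ a b : EN N, ‖a - b‖ ≤ r → wp a - M / 8 < wp b ∧ wp b < wp a + M / 8 := by
    intro a b hab
    have := hdist (a := a) (b := b) (by rw [dist_eq_norm]; linarith)
    rw [Real.dist_eq, abs_lt] at this
    constructor <;> linarith [this.1, this.2]
  let f : ContDiffBump (0 : EN N) := ⟨r / 2, r, by positivity, by linarith⟩
  set ρ : EN N → ℝ := f.normed volume with hρdef
  have hρ : ContDiff ℝ (⊤ : ℕ∞) ρ := f.contDiff_normed
  have hρc : HasCompactSupport ρ := f.hasCompactSupport_normed
  have hρ0 : ∀ t, 0 ≤ ρ t := f.nonneg_normed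
  have hρs : ∀ t, r ≤ ‖t‖ → ρ t = 0 := by
    intro t ht
    by_contra h
    have h2 : t ∈ Function.support (f.normed volume) := h
    rw [f.support_normed_eq] at h2
    have h3 : ‖t‖ < r := by simpa using h2
    linarith
  have hρint : ∀ a : EN N, ∫ y, ρ (a - y) = 1 := by
    intro a
    rw [integral_sub_left_eq_self (fun y => ρ y) volume a]
    exact f.integral_normed
  have hρi : ∀ a : EN N, Integrable (fun y => ρ (a - y)) := fun a =>
    (f.integrable_normed (μ := volume)).comp_sub_left a
  have hci := conv_integrable hρ.continuous hρc hwL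
  set W : EN N → ℝ := fun x => ∫ y, w y * ρ (x - y) with hW
  have hWc : Continuous W :=
    hρc.continuous_convolution_right (ContinuousLinearMap.mul ℝ ℝ) hwL.locInt hρ.continuous
  have hWlow : 7 * M / 8 ≤ W x0 := by
    have : ∫ y, (7 * M / 8) * ρ (x0 - y) ≤ W x0 := by
      refine integral_mono ((hρi x0).const_mul _) (hci x0) fun y => ?_
      rcases le_total r ‖x0 - y‖ with h | h
      · simp [hρs _ h]
      · refine mul_le_mul_of_nonneg_right ?_ (hρ0 _)
        have h1 := (hclose x0 y h).1
        rw [(hwpin y (by linarith)).2]; linarith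
    rwa [integral_const_mul, hρint, mul_one] at this
  have hWup : ∀ x, wp x < M / 2 → W x ≤ 5 * M / 8 := by
    intro x hx
    have : W x ≤ ∫ y, (5 * M / 8) * ρ (x - y) := by
      refine integral_mono (hci x) ((hρi x).const_mul _) fun y => ?_
      rcases le_total r ‖x - y‖ with h | h
      · simp [hρs _ h]
      · refine mul_le_mul_of_nonneg_right ?_ (hρ0 _)
        have h1 := (hclose x y h).2
        have h2 : w y ≤ wp y := le_max_left _ _
        linarith
    rwa [integral_const_mul, hρint, mul_one] at this
  have hK : IsCompact {x : EN N | M / 2 ≤ wp x} := by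
    refine (isCompact_closedBall (0 : EN N) 1).of_isClosed_subset
      (isClosed_le continuous_const hwpc) fun x hx => ?_
    have hx' : M / 2 ≤ wp x := hx
    simpa using (hwpin x (by linarith)).1.le
  obtain ⟨x, hxK, hxmax⟩ := hK.exists_isMaxOn ⟨x0, by change M / 2 ≤ wp x0; linarith⟩
    hWc.continuousOn
  have hxK' : M / 2 ≤ wp x := hxK
  have hx01 : W x0 ≤ W x := hxmax (by change M / 2 ≤ wp x0; linarith)
  have hmax : ∀ x', W x' ≤ W x := by
    intro x'
    by_cases h : M / 2 ≤ wp x'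
    · exact hxmax h
    · linarith [hWup x' (not_le.1 h)]
  have hnear : ∀ y, ‖x - y‖ ≤ r → ‖y‖ < 1 ∧ u y ≤ v y := by
    intro y hy
    have h1 := (hclose x y hy).1
    have h2 := hwpin y (by linarith)
    refine ⟨h2.1, ?_⟩
    have h3 : v y - u y = wp y := h2.2
    linarith
  have hts : tsupport (fun y => ρ (x - y)) ⊆ ball (0 : EN N) 1 := by
    have h1 : tsupport (fun y => ρ (x - y)) ⊆ closedBall x r := by
      refine closure_minimal (fun y hy => ?_) isClosed_closedBall
      by_contra h
      refine hy (hρs _ ?_)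
      rw [mem_closedBall, dist_eq_norm, norm_sub_rev] at h
      linarith
    intro y hy
    have h2 := h1 hy
    rw [mem_closedBall, dist_eq_norm, norm_sub_rev] at h2
    simpa using (hnear y h2).1
  have hneg : ∀ x', 3 < ‖x' - x‖ → ∫ y, w y * ρ (x' - y) ≤ 0 := by
    intro x' hx'
    refine integral_nonpos fun y => ?_
    rcases le_total r ‖x' - y‖ with h | h
    · simp [hρs _ h]
    · refine mul_nonpos_of_nonpos_of_nonneg (hwout y ?_) (hρ0 _)
      have h1 : ‖x‖ < 1 := (hwpin x (by linarith)).1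
      have h2 := norm_sub_le x' x
      have h3 := norm_sub_norm_le x' y
      linarith
  have hlt := max_step N hN α hα0 hα2 ρ hρ hρc x hts w hwL hmax
    (by change 0 < W x; linarith) hneg
  set φ : EN N → ℝ := fun y => ρ (x - y) with hφdef
  have hφ : ContDiff ℝ (⊤ : ℕ∞) φ := hρ.comp (contDiff_const.sub contDiff_id)
  have hφc : HasCompactSupport φ := hρc.comp_homeomorph (Homeomorph.subLeft x)
  have a1 := hsub φ hφ hφc hts fun y => hρ0 _
  have a2 := hsup φ hφ hφc hts fun y => hρ0 _
  have a3 : ∫ y, u y ^ γ * φ y ≤ ∫ y, v y ^ γ * φ y := by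
    refine integral_mono_of_nonneg (Eventually.of_forall fun y => ?_) ?_
      (Eventually.of_forall fun y => ?_)
    · exact mul_nonneg (Real.rpow_nonneg (hu0 y) _) (hρ0 _)
    · have h1 : ContinuousOn (fun y => v y ^ γ * φ y) (closedBall (0 : EN N) 1) :=
        (hvc.rpow_const fun y _ => Or.inr hγ.le).mul hφ.continuous.continuousOn
      refine (integrableOn_iff_integrable_of_support_subset ?_).1
        (h1.integrableOn_compact (isCompact_closedBall (0 : EN N) 1))
      intro y hy
      have hy2 : φ y ≠ 0 := right_ne_zero_of_mul hy
      exact ball_subset_closedBall (hts (subset_tsupport _ hy2))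
    · change u y ^ γ * φ y ≤ v y ^ γ * φ y
      rcases le_total r ‖x - y‖ with h | h
      · have : φ y = 0 := hρs _ h
        rw [this]; simp
      · exact mul_le_mul_of_nonneg_right
          (Real.rpow_le_rpow (hu0 y) (hnear y h).2 hγ.le) (hρ0 _)
  have b1 := (integral_fracLap N hN α hα0 hα2 φ hφ hφc hts u huL).1
  have b2 := (integral_fracLap N hN α hα0 hα2 φ hφ hφc hts v hvL).1
  have b3 : ∫ y, w y * fracLap N α φ y =
      (∫ y, v y * fracLap N α φ y) - ∫ y, u y * fracLap N α φ y := by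
    rw [← integral_sub b2 b1]
    congr 1; ext y; simp only [hwdef]; ring
  linarith

end
end
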